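/- Qgap(12) = 47255689915; that is, N = 47255689915 starts a squarefree gap of length exactly 12 (the twelve consecutive integers 47255689915, …, 47255689926 are not squarefree while 47255689914 and 47255689927 are squarefree), and 47255689915 is the least positive integer starting a squarefree gap of length exactly 12. -/

import Mathlib

/-- `N` starts a squarefree gap of length exactly `L`: none of the `L` consecutive
integers `N, N+1, …, N+L-1` is squarefree, while both `N-1` and `N+L` are squarefree. -/
def StartsSquarefreeGap (N L : ℕ) : Prop :=
  2 ≤ N ∧ 1 ≤ L ∧ (∀ i < L, ¬ Squarefree (N + i)) ∧ Squarefree (N - 1) ∧ Squarefree (N + L)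

set_option maxRecDepth 100000

/-- The odd primes below `2000`, in rows. -/
def oddRows : List (List ℕ) :=
  [
    [nat_lit 3],
    [nat_lit 5],
    [nat_lit 7],
    [nat_lit 11],
    [nat_lit 13],
    [nat_lit 17],
    [nat_lit 19],
    [nat_lit 23],
    [nat_lit 29, nat_lit 31],
    [nat_lit 37, nat_lit 41],
    [nat_lit 43, nat_lit 47],
    [nat_lit 53, nat_lit 59, nat_lit 61],
    [nat_lit 67, nat_lit 71, nat_lit 73, nat_lit 79],
    [nat_lit 83, nat_lit 89, nat_lit 97, nat_lit 101, nat_lit 103],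
    [nat_lit 107, nat_lit 109, nat_lit 113, nat_lit 127, nat_lit 131, nat_lit 137, nat_lit
    139],
    [nat_lit 149, nat_lit 151, nat_lit 157, nat_lit 163, nat_lit 167, nat_lit 173, nat_lit
    179, nat_lit 181, nat_lit 191, nat_lit 193, nat_lit 197, nat_lit 199, nat_lit 211, nat_lit
    223, nat_lit 227, nat_lit 229, nat_lit 233, nat_lit 239],
    [nat_lit 241, nat_lit 251, nat_lit 257, nat_lit 263, nat_lit 269, nat_lit 271, nat_lit
    277, nat_lit 281, nat_lit 283, nat_lit 293, nat_lit 307, nat_lit 311, nat_lit 313, nat_lit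
    317, nat_lit 331, nat_lit 337, nat_lit 347, nat_lit 349],
    [nat_lit 353, nat_lit 359, nat_lit 367, nat_lit 373, nat_lit 379, nat_lit 383, nat_lit
    389, nat_lit 397, nat_lit 401, nat_lit 409, nat_lit 419, nat_lit 421, nat_lit 431, nat_lit
    433, nat_lit 439, nat_lit 443, nat_lit 449, nat_lit 457],
    [nat_lit 461, nat_lit 463, nat_lit 467, nat_lit 479, nat_lit 487, nat_lit 491, nat_lit
    499, nat_lit 503, nat_lit 509, nat_lit 521, nat_lit 523, nat_lit 541, nat_lit 547, nat_lit
    557, nat_lit 563, nat_lit 569, nat_lit 571, nat_lit 577],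
    [nat_lit 587, nat_lit 593, nat_lit 599, nat_lit 601, nat_lit 607, nat_lit 613, nat_lit
    617, nat_lit 619, nat_lit 631, nat_lit 641, nat_lit 643, nat_lit 647, nat_lit 653, nat_lit
    659, nat_lit 661, nat_lit 673, nat_lit 677, nat_lit 683],
    [nat_lit 691, nat_lit 701, nat_lit 709, nat_lit 719, nat_lit 727, nat_lit 733, nat_lit
    739, nat_lit 743, nat_lit 751, nat_lit 757, nat_lit 761, nat_lit 769, nat_lit 773, nat_lit
    787, nat_lit 797, nat_lit 809, nat_lit 811, nat_lit 821],
    [nat_lit 823, nat_lit 827, nat_lit 829, nat_lit 839, nat_lit 853, nat_lit 857, nat_lit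
    859, nat_lit 863, nat_lit 877, nat_lit 881, nat_lit 883, nat_lit 887, nat_lit 907, nat_lit
    911, nat_lit 919, nat_lit 929, nat_lit 937, nat_lit 941],
    [nat_lit 947, nat_lit 953, nat_lit 967, nat_lit 971, nat_lit 977, nat_lit 983, nat_lit
    991, nat_lit 997, nat_lit 1009, nat_lit 1013, nat_lit 1019, nat_lit 1021, nat_lit 1031,
    nat_lit 1033, nat_lit 1039, nat_lit 1049, nat_lit 1051, nat_lit 1061],
    [nat_lit 1063, nat_lit 1069, nat_lit 1087, nat_lit 1091, nat_lit 1093, nat_lit 1097,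
    nat_lit 1103, nat_lit 1109, nat_lit 1117, nat_lit 1123, nat_lit 1129, nat_lit 1151,
    nat_lit 1153, nat_lit 1163, nat_lit 1171, nat_lit 1181, nat_lit 1187, nat_lit 1193],
    [nat_lit 1201, nat_lit 1213, nat_lit 1217, nat_lit 1223, nat_lit 1229, nat_lit 1231,
    nat_lit 1237, nat_lit 1249, nat_lit 1259, nat_lit 1277, nat_lit 1279, nat_lit 1283,
    nat_lit 1289, nat_lit 1291, nat_lit 1297, nat_lit 1301, nat_lit 1303, nat_lit 1307],
    [nat_lit 1319, nat_lit 1321, nat_lit 1327, nat_lit 1361, nat_lit 1367, nat_lit 1373,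
    nat_lit 1381, nat_lit 1399, nat_lit 1409, nat_lit 1423, nat_lit 1427, nat_lit 1429,
    nat_lit 1433, nat_lit 1439, nat_lit 1447, nat_lit 1451, nat_lit 1453, nat_lit 1459],
    [nat_lit 1471, nat_lit 1481, nat_lit 1483, nat_lit 1487, nat_lit 1489, nat_lit 1493,
    nat_lit 1499, nat_lit 1511, nat_lit 1523, nat_lit 1531, nat_lit 1543, nat_lit 1549,
    nat_lit 1553, nat_lit 1559, nat_lit 1567, nat_lit 1571, nat_lit 1579, nat_lit 1583],
    [nat_lit 1597, nat_lit 1601, nat_lit 1607, nat_lit 1609, nat_lit 1613, nat_lit 1619,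
    nat_lit 1621, nat_lit 1627, nat_lit 1637, nat_lit 1657, nat_lit 1663, nat_lit 1667,
    nat_lit 1669, nat_lit 1693, nat_lit 1697, nat_lit 1699, nat_lit 1709, nat_lit 1721],
    [nat_lit 1723, nat_lit 1733, nat_lit 1741, nat_lit 1747, nat_lit 1753, nat_lit 1759,
    nat_lit 1777, nat_lit 1783, nat_lit 1787, nat_lit 1789, nat_lit 1801, nat_lit 1811,
    nat_lit 1823, nat_lit 1831, nat_lit 1847, nat_lit 1861, nat_lit 1867, nat_lit 1871],
    [nat_lit 1873, nat_lit 1877, nat_lit 1879, nat_lit 1889, nat_lit 1901, nat_lit 1907,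
    nat_lit 1913, nat_lit 1931, nat_lit 1933, nat_lit 1949, nat_lit 1951, nat_lit 1973,
    nat_lit 1979, nat_lit 1987, nat_lit 1993, nat_lit 1997, nat_lit 1999]]

/-- The remaining primes up to `3623`. -/
def otherPrimes : List ℕ :=
  [
    nat_lit 2, nat_lit 2003, nat_lit 2011, nat_lit 2017, nat_lit 2027, nat_lit 2029, nat_lit
    2039, nat_lit 2053, nat_lit 2063, nat_lit 2069, nat_lit 2081, nat_lit 2083, nat_lit 2087,
    nat_lit 2089, nat_lit 2099, nat_lit 2111, nat_lit 2113, nat_lit 2129, nat_lit 2131,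
    nat_lit 2137, nat_lit 2141, nat_lit 2143, nat_lit 2153, nat_lit 2161, nat_lit 2179,
    nat_lit 2203, nat_lit 2207, nat_lit 2213, nat_lit 2221, nat_lit 2237, nat_lit 2239,
    nat_lit 2243, nat_lit 2251, nat_lit 2267, nat_lit 2269, nat_lit 2273, nat_lit 2281,
    nat_lit 2287, nat_lit 2293, nat_lit 2297, nat_lit 2309, nat_lit 2311, nat_lit 2333,
    nat_lit 2339, nat_lit 2341, nat_lit 2347, nat_lit 2351, nat_lit 2357, nat_lit 2371,
    nat_lit 2377, nat_lit 2381, nat_lit 2383, nat_lit 2389, nat_lit 2393, nat_lit 2399,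
    nat_lit 2411, nat_lit 2417, nat_lit 2423, nat_lit 2437, nat_lit 2441, nat_lit 2447,
    nat_lit 2459, nat_lit 2467, nat_lit 2473, nat_lit 2477, nat_lit 2503, nat_lit 2521,
    nat_lit 2531, nat_lit 2539, nat_lit 2543, nat_lit 2549, nat_lit 2551, nat_lit 2557,
    nat_lit 2579, nat_lit 2591, nat_lit 2593, nat_lit 2609, nat_lit 2617, nat_lit 2621,
    nat_lit 2633, nat_lit 2647, nat_lit 2657, nat_lit 2659, nat_lit 2663, nat_lit 2671,
    nat_lit 2677, nat_lit 2683, nat_lit 2687, nat_lit 2689, nat_lit 2693, nat_lit 2699,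
    nat_lit 2707, nat_lit 2711, nat_lit 2713, nat_lit 2719, nat_lit 2729, nat_lit 2731,
    nat_lit 2741, nat_lit 2749, nat_lit 2753, nat_lit 2767, nat_lit 2777, nat_lit 2789,
    nat_lit 2791, nat_lit 2797, nat_lit 2801, nat_lit 2803, nat_lit 2819, nat_lit 2833,
    nat_lit 2837, nat_lit 2843, nat_lit 2851, nat_lit 2857, nat_lit 2861, nat_lit 2879,
    nat_lit 2887, nat_lit 2897, nat_lit 2903, nat_lit 2909, nat_lit 2917, nat_lit 2927,
    nat_lit 2939, nat_lit 2953, nat_lit 2957, nat_lit 2963, nat_lit 2969, nat_lit 2971,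
    nat_lit 2999, nat_lit 3001, nat_lit 3011, nat_lit 3019, nat_lit 3023, nat_lit 3037,
    nat_lit 3041, nat_lit 3049, nat_lit 3061, nat_lit 3067, nat_lit 3079, nat_lit 3083,
    nat_lit 3089, nat_lit 3109, nat_lit 3119, nat_lit 3121, nat_lit 3137, nat_lit 3163,
    nat_lit 3167, nat_lit 3169, nat_lit 3181, nat_lit 3187, nat_lit 3191, nat_lit 3203,
    nat_lit 3209, nat_lit 3217, nat_lit 3221, nat_lit 3229, nat_lit 3251, nat_lit 3253,
    nat_lit 3257, nat_lit 3259, nat_lit 3271, nat_lit 3299, nat_lit 3301, nat_lit 3307,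
    nat_lit 3313, nat_lit 3319, nat_lit 3323, nat_lit 3329, nat_lit 3331, nat_lit 3343,
    nat_lit 3347, nat_lit 3359, nat_lit 3361, nat_lit 3371, nat_lit 3373, nat_lit 3389,
    nat_lit 3391, nat_lit 3407, nat_lit 3413, nat_lit 3433, nat_lit 3449, nat_lit 3457,
    nat_lit 3461, nat_lit 3463, nat_lit 3467, nat_lit 3469, nat_lit 3491, nat_lit 3499,
    nat_lit 3511, nat_lit 3517, nat_lit 3527, nat_lit 3529, nat_lit 3533, nat_lit 3539,
    nat_lit 3541, nat_lit 3547, nat_lit 3557, nat_lit 3559, nat_lit 3571, nat_lit 3581,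
    nat_lit 3583, nat_lit 3593, nat_lit 3607, nat_lit 3613, nat_lit 3617, nat_lit 3623]

/-- The product of all primes up to `3623`. -/
def primeProd : ℕ := nat_lit 4389895177235571289718838451279289767752787414320614068046955721977696458761957085333370054482858965989196094055356554767363101168855970956985783260341853975582424617797193426917647475962171404908410308560341964489951077002640889219951267818616527726932141199335760605057772768687305366954579768180526306443521593699001936476838784774947542323095724896109021579834151204732976559439325663288607888650022517455244640441859395606919490251974157303038229975776734483520439477043568529854854277206489169858825632168784297230587678116964221559684952397983727355009254942740197909404557832803996547790030150665343703800731302186588188560773721638604290941386948809710159824187570468591076513835353355629319390969708287492099805017175455315429249594710664573514718171054555812760040941887383680508675853794625820322127488933994879710630676625878308568821398712582770284188525665611178130017128516414902114074827715764177554486530001148288396853417256911353056962174124708168799635859456631029799509629473416121784256691447443370098595382779718709623363966205633218219096432673654225290683149350657739839844614057838443979770940152737791221160399856146050550502135855818033436591864047991404972993768651021706119405190626830805017228272434250553894258763877998648645522738865378168769716620005698580836332149499718009409690078197147247977176325827946480501062832730595349939739984783523924264174261403177120678799298317654360305984253088399824401583303357978618362800913863049124569743610454216685219151482629914495363560511786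11752065708414213846315910

/-- The product of all odd primes below `2000`. -/
def oddProd : ℕ := nat_lit 144687320981472800926307834843176219278599194550817752960989343766767301592049551678356610122522844691096989514233278311650464193213434320632758942880887250349927084900420342652825285952663196945573721751761396930292035795726439827887867161996723640114975258104084228121429852269772521514735361508441531064932594491653722879972065893781888876118267021419368285912884073654937939784324380924246237346134537868996910255484423529898875068869289840291753520743842508574762313958031822187543034499747649490674888270160398369241635986356224786964434695073439339139275853366482373477907510709424531913290192185935955831056625644212298509525752905828727731314592111617584101317875781359261303258349311198012559442467199663089503046558790002295908099688926938152583269357634743248456982669149509320781859206327603496583207554702901438996474178384577335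

/-- The largest block start that has to be considered. -/
def topZ : ℕ := nat_lit 47255689912

/-- If this holds, `n` has no square factor `r ^ 2` with `r` an odd prime below `2000`. -/
def tS (n : ℕ) : Bool :=
  (fun g => Nat.beq (Nat.gcd (Nat.div n g) g) (nat_lit 1))
    (Nat.gcd n (Nat.mod (nat_lit 144687320981472800926307834843176219278599194550817752960989343766767301592049551678356610122522844691096989514233278311650464193213434320632758942880887250349927084900420342652825285952663196945573721751761396930292035795726439827887867161996723640114975258104084228121429852269772521514735361508441531064932594491653722879972065893781888876118267021419368285912884073654937939784324380924246237346134537868996910255484423529898875068869289840291753520743842508574762313958031822187543034499747649490674888270160398369241635986356224786964434695073439339139275853366482373477907510709424531913290192185935955831056625644212298509525752905828727731314592111617584101317875781359261303258349311198012559442467199663089503046558790002295908099688926938152583269357634743248456982669149509320781859206327603496583207554702901438996474178384577335) n))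

/-- Nonzero if `c` is a square (bit mask of the squares modulo `840`). -/
def sqBit (c : ℕ) : ℕ :=
  Nat.land (nat_lit 1) (Nat.shiftRight (nat_lit 7428914895946386037144320536063943465961824356111151767129051755307583941165109228054524270322783668000574978987740932624689661568580347725348753686224473267755671456908102293247554908460467896780744620282805554048360721891700862234106997321564691) (Nat.mod c (nat_lit 840)))

/-- Nonzero if `c` is a square (bit mask of the squares modulo `143`). -/
def sqBitB (c : ℕ) : ℕ :=
  Nat.land (nat_lit 1) (Nat.shiftRight (nat_lit 12337925766874303876000583143494390993435) (Nat.mod c (nat_lit 143)))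

/-- Nonzero if `c` is a square (bit mask of the squares modulo `323`). -/
def sqBitC (c : ℕ) : ℕ :=
  Nat.land (nat_lit 1) (Nat.shiftRight (nat_lit 4341437005659545356311106875435249476073376895144305954155417450284306736590537326127758294319635) (Nat.mod c (nat_lit 323)))

/-- If this holds (and `n` is not too large), `n` is squarefree. -/
def sf (n : ℕ) : Bool :=
  (fun g => (fun c => Nat.beq (Nat.add (Nat.gcd c g)
      (Nat.land (nat_lit 1) (Nat.shiftRight (nat_lit 7428914895946386037144320536063943465961824356111151767129051755307583941165109228054524270322783668000574978987740932624689661568580347725348753686224473267755671456908102293247554908460467896780744620282805554048360721891700862234106997321564691) (Nat.mod c (nat_lit 840)))))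
        (nat_lit 1))
    (Nat.div n g)) (Nat.gcd n (Nat.mod (nat_lit 438989517723557128971883845127928976775278741432061406804695572197769645876195708533337005448285896598919609405535655476736310116885597095698578326034185397558242461779719342691764747596217140490841030856034196448995107700264088921995126781861652772693214119933576060505777276868730536695457976818052630644352159369900193647683878477494754232309572489610902157983415120473297655943932566328860788865002251745524464044185939560691949025197415730303822997577673448352043947704356852985485427720648916985882563216878429723058767811696422155968495239798372735500925494274019790940455783280399654779003015066534370380073130218658818856077372163860429094138694880971015982418757046859107651383535335562931939096970828749209980501717545531542924959471066457351471817105455581276004094188738368050867585379462582032212748893399487971063067662587830856882139871258277028418852566561117813001712851641490211407482771576417755448653000114828839685341725691135305696217412470816879963585945663102979950962947341612178425669144744337009859538277971870962336396620563321821909643267365422529068314935065773983984461405783844397977094015273779122116039985614605055050213585581803343659186404799140497299376865102170611940519062683080501722827243425055389425876387799864864552273886537816876971662000569858083633214949971800940969007819714724797717632582794648050106283273059534993973998478352392426417426140317712067879929831765436030598425308839982440158330335797861836280091386304912456974361045421668521915148262991449536356051178611752065708414213846315910) n))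

/-- Boolean conjunction, lazy in the second argument. -/
noncomputable def bAnd (x y : Bool) : Bool := @Bool.rec (fun _ => Bool) false y x

/-- Boolean disjunction, lazy in the second argument. -/
noncomputable def bOr (x y : Bool) : Bool := @Bool.rec (fun _ => Bool) y true x

/-- A sharper version of `sf`, used rarely. -/
noncomputable def sfx (n : ℕ) : Bool :=
  (fun g => (fun c => bAnd (Nat.beq (Nat.gcd c g) (nat_lit 1))
      (bOr (Nat.beq (sqBit c) (nat_lit 0)) (bOr (Nat.beq c (nat_lit 1))
        (bOr (Nat.beq (sqBitB c) (nat_lit 0)) (Nat.beq (sqBitC c) (nat_lit 0))))))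
    (Nat.div n g)) (Nat.gcd n (Nat.mod primeProd n))

/-- No window around the block `b` survives outside `b + 1, …, b + 7`. -/
noncomputable def edge (b : ℕ) : Bool :=
  bOr (sfx (Nat.add b (nat_lit 9)))
    (bAnd
      (bOr (sfx (Nat.sub b (nat_lit 1)))
        (bAnd (sfx (Nat.sub b (nat_lit 2))) (sfx (Nat.add b (nat_lit 10)))))
      (bOr (sfx (Nat.add b (nat_lit 10))) (sfx (Nat.add b (nat_lit 11)))))

/-- Fallback in the large prime case, for the triple starting after `t`. -/
noncomputable def fallb (t : ℕ) : Bool :=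
  bAnd
    (bOr (sfx (Nat.add t (nat_lit 5))) (bOr (sfx (Nat.add t (nat_lit 6)))
      (bOr (sfx (Nat.add t (nat_lit 7))) (edge t))))
    (bOr (sfx (Nat.sub t (nat_lit 3))) (bOr (sfx (Nat.sub t (nat_lit 2)))
      (bOr (sfx (Nat.sub t (nat_lit 1))) (edge (Nat.sub t (nat_lit 4))))))

/-- Check all `f k` for `k < d`. -/
noncomputable def upTo (f : ℕ → Bool) (d : ℕ) : Bool :=
  @Nat.rec (fun _ => Bool) true (fun k ih => @Bool.rec (fun _ => Bool) false ih (f k)) d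

/-- Evaluate the argument before calling `f`. -/
noncomputable def force (f : ℕ → Bool) (n : ℕ) : Bool :=
  @Nat.rec (fun _ => Bool) false (fun k _ => f k) (Nat.add n (nat_lit 1))

/-- Split a loop with `D` steps of width `m` into pieces of `c` steps. -/
noncomputable def chunk (f : ℕ → ℕ → Bool) (a m c D : ℕ) : Bool :=
  upTo (fun j => force (fun e => force (fun d => f e d)
      (Nat.sub c (Nat.sub (Nat.mul c (Nat.add j (nat_lit 1))) D)))
    (Nat.add a (Nat.mul m (Nat.mul c j)))) (Nat.add (Nat.div D c) (nat_lit 1))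

/-- Loop of the large prime case: `t = e + m * k`, other positions `v`, `w`. -/
noncomputable def bigLoop (m v w e d : ℕ) : Bool :=
  @Nat.rec (fun _ => Bool) true
    (fun k ih => @Bool.rec (fun _ => Bool)
      (@Bool.rec (fun _ => Bool)
        (@Bool.rec (fun _ => Bool) false ih (fallb (Nat.add e (Nat.mul m k))))
        ih (sf (Nat.add (Nat.add e (Nat.mul m k)) w)))
      ih (sf (Nat.add (Nat.add e (Nat.mul m k)) v))) d

/-- Large prime case for a fixed position. -/
noncomputable def bigPos (e m v w : ℕ) : Bool :=
  @Bool.rec (fun _ => Bool) true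
    (chunk (fun eNew d => bigLoop m v w eNew d) e m (nat_lit 40)
      (Nat.add (Nat.div (Nat.sub (nat_lit 47255689912) e) m) (nat_lit 1)))
    (Nat.ble e (nat_lit 47255689912))

/-- Large prime case for a fixed square `q = p ^ 2`. -/
noncomputable def bigSq (q : ℕ) : Bool :=
  bAnd (force (fun m => bigPos (Nat.sub q (nat_lit 1)) m (nat_lit 2) (nat_lit 3))
      (Nat.mul (nat_lit 4) q))
    (bAnd (force (fun m => bigPos (Nat.sub (Nat.mul (nat_lit 2) q) (nat_lit 2)) m
          (nat_lit 1) (nat_lit 3)) (Nat.mul (nat_lit 4) q))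
      (force (fun m => bigPos (Nat.sub (Nat.mul (nat_lit 3) q) (nat_lit 3)) m
          (nat_lit 1) (nat_lit 2)) (Nat.mul (nat_lit 4) q)))

/-- Large prime case for `p`. -/
noncomputable def bigOne (p : ℕ) : Bool :=
  @Bool.rec (fun _ => Bool) true (bigSq (Nat.mul p p))
    (Nat.beq (Nat.gcd p (nat_lit 144687320981472800926307834843176219278599194550817752960989343766767301592049551678356610122522844691096989514233278311650464193213434320632758942880887250349927084900420342652825285952663196945573721751761396930292035795726439827887867161996723640114975258104084228121429852269772521514735361508441531064932594491653722879972065893781888876118267021419368285912884073654937939784324380924246237346134537868996910255484423529898875068869289840291753520743842508574762313958031822187543034499747649490674888270160398369241635986356224786964434695073439339139275853366482373477907510709424531913290192185935955831056625644212298509525752905828727731314592111617584101317875781359261303258349311198012559442467199663089503046558790002295908099688926938152583269357634743248456982669149509320781859206327603496583207554702901438996474178384577335)) (nat_lit 1))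

/-- Large prime case for `p = p₀ + 2 k`, `k < D`. -/
noncomputable def bigRange (p₀ D : ℕ) : Bool :=
  chunk (fun p d => upTo (fun k => bigOne (Nat.add p (Nat.mul (nat_lit 2) k))) d) p₀
    (nat_lit 2) (nat_lit 100) D

/-- Check of a single block start `b` at the remaining positions. -/
noncomputable def leafChk (U : List ℕ) (b : ℕ) : Bool :=
  @List.rec ℕ (fun _ => Bool) (edge b)
    (fun u _ ih => @Bool.rec (fun _ => Bool) ih true (tS (Nat.add b u))) U

/-- Loop over the block starts `a + M * k`, with `u` the first open position. -/
noncomputable def leafLoop (U : List ℕ) (u M a d : ℕ) : Bool :=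
  @Nat.rec (fun _ => Bool) true
    (fun k ih => @Bool.rec (fun _ => Bool)
      (@Bool.rec (fun _ => Bool) false ih (leafChk U (Nat.add a (Nat.mul M k))))
      ih (tS (Nat.add (Nat.add a (Nat.mul M k)) u))) d

/-- Solution of `aNew ≡ a (mod M)`, `aNew ≡ -u (mod r ^ 2)` (checked afterwards). -/
def crt (u M a r : ℕ) : ℕ :=
  (fun q => (fun i =>
    Nat.add a (Nat.mul M (Nat.mod (Nat.mul (Nat.sub q (Nat.mod (Nat.add a u) q))
      (Nat.mul i (Nat.add (Nat.mul (Nat.mul (Nat.sub q (nat_lit 1)) (Nat.mod M q)) i)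
        (nat_lit 2)))) q)))
    (Nat.mod (Nat.pow (Nat.mod M r) (Nat.sub r (nat_lit 2))) r)) (Nat.mul r r)

/-- The second half of `step`. -/
noncomputable def stepAux (cont : ℕ → ℕ → Bool) (u M r aNew : ℕ) : Bool :=
  @Bool.rec (fun _ => Bool)
    (@Bool.rec (fun _ => Bool) false
      (force (fun mNew => cont mNew aNew) (Nat.mul M (Nat.mul r r)))
      (Nat.beq (Nat.mod (Nat.add aNew u) (Nat.mul r r)) (nat_lit 0)))
    (Nat.beq (Nat.mod (Nat.add aNew u) (Nat.mul r r)) (nat_lit 0))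
    (Nat.ble (nat_lit 47255689913) aNew)

/-- One branch of the search: position `u` is divisible by `r ^ 2`. -/
noncomputable def step (cont : ℕ → ℕ → Bool) (u M a r : ℕ) : Bool :=
  @Bool.rec (fun _ => Bool)
    (force (fun aNew => stepAux cont u M r aNew) (crt u M a r))
    true (Nat.beq (Nat.mod M r) (nat_lit 0))

/-- The branches of the search for one row of primes. -/
noncomputable def branch (cont : ℕ → ℕ → Bool) (u M a : ℕ) (L : List ℕ) : Bool :=
  @List.rec ℕ (fun _ => Bool) true
    (fun r _ ih => @Bool.rec (fun _ => Bool) false ih (step cont u M a r)) L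

/-- The branches of the search for some rows of primes. -/
noncomputable def branches (cont : ℕ → ℕ → Bool) (u M a : ℕ) (LL : List (List ℕ)) : Bool :=
  @List.rec (List ℕ) (fun _ => Bool) true
    (fun L _ ih => @Bool.rec (fun _ => Bool) false ih (branch cont u M a L)) LL

/-- The search; `U` is the list of open positions, block starts are `≡ a (mod M)`. -/
noncomputable def dfs (U : List ℕ) : ℕ → ℕ → Bool :=
  @List.rec ℕ (fun _ => ℕ → ℕ → Bool) (fun _ _ => false)
    (fun u uTail ih M a => @Bool.rec (fun _ => Bool)
      (branches ih u M a oddRows)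
      (chunk (fun aNew d => leafLoop uTail u M aNew d) a M (nat_lit 40)
        (Nat.add (Nat.div (Nat.sub (nat_lit 47255689912) a) M) (nat_lit 1)))
      (Nat.ble (nat_lit 47255689912) (Nat.mul (nat_lit 1000) M))) U

/-! ### Evaluation lemmas -/

theorem bAnd_true {x y : Bool} : bAnd x y = true ↔ x = true ∧ y = true := by
  cases x <;> cases y <;> simp [bAnd]

theorem bOr_true {x y : Bool} : bOr x y = true ↔ x = true ∨ y = true := by
  cases x <;> cases y <;> simp [bOr]

theorem upTo_spec {f : ℕ → Bool} {d : ℕ} (h : upTo f d = true) : ∀ k < d, f k = true := by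
  induction d with
  | zero => intro k hk; omega
  | succ d ih =>
    have h1 : @Bool.rec (fun _ => Bool) false (upTo f d) (f d) = true := h
    intro k hk
    cases hf : f d with
    | false => rw [hf] at h1; exact absurd h1 (by simp)
    | true =>
      rw [hf] at h1
      rcases Nat.lt_succ_iff_lt_or_eq.mp hk with hk | rfl
      · exact ih h1 k hk
      · exact hf

theorem force_eq (f : ℕ → Bool) (n : ℕ) : force f n = f n := rfl

theorem chunk_spec {f : ℕ → ℕ → Bool} {a m c D : ℕ} (P : ℕ → Prop) (hc : 0 < c)
    (hf : ∀ e d, f e d = true → ∀ k < d, P (e + m * k))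
    (h : chunk f a m c D = true) : ∀ k < D, P (a + m * k) := by
  intro k hk
  have h1 := upTo_spec h (k / c) (by
    show k / c < D / c + 1
    exact Nat.lt_succ_of_le (Nat.div_le_div_right hk.le))
  rw [force_eq, force_eq] at h1
  have h2 := hf _ _ h1 (k % c) (by
    show k % c < c - (c * (k / c + 1) - D)
    have h3 := Nat.div_add_mod k c
    have h4 := Nat.mod_lt k hc
    rw [Nat.mul_add]
    omega)
  have h3 : a + m * (c * (k / c)) + m * (k % c) = a + m * k := by
    conv_rhs => rw [← Nat.div_add_mod k c]
    ring
  rw [← h3]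
  exact h2

/-! ### Squarefreeness tests -/

theorem dvd_of_test {S n r : ℕ} (hp : r.Prime) (hr : r ∣ S) (hr2 : ¬ r * r ∣ S) 
    (h : Nat.gcd (n / Nat.gcd n S) (Nat.gcd n S) = 1) : ¬ r * r ∣ n := by
  intro hd
  have hg : r ∣ Nat.gcd n S := Nat.dvd_gcd (dvd_trans (dvd_mul_left r r) hd) hr
  obtain ⟨g, hg'⟩ := hg
  have hrg : ¬ r ∣ g := by
    rintro ⟨e, rfl⟩
    apply hr2
    refine dvd_trans ?_ (Nat.gcd_dvd_right n S)
    rw [hg']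
    exact ⟨e, by ring⟩
  have hn : n = Nat.gcd n S * (n / Nat.gcd n S) := (Nat.mul_div_cancel' (Nat.gcd_dvd_left n S)).symm
  have h1 : r * r ∣ r * (g * (n / Nat.gcd n S)) := by
    rw [← mul_assoc, ← hg', ← hn]; exact hd
  have h2 : r ∣ g * (n / Nat.gcd n S) := Nat.dvd_of_mul_dvd_mul_left hp.pos h1
  have h3 : r ∣ n / Nat.gcd n S := (hp.dvd_mul.mp h2).resolve_left hrg
  have h4 : r ∣ Nat.gcd (n / Nat.gcd n S) (Nat.gcd n S) := Nat.dvd_gcd h3 ⟨g, hg'⟩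
  rw [h] at h4
  exact hp.one_lt.ne' (Nat.dvd_one.mp h4)

/-- The odd primes below `2000`. -/
def oddList : List ℕ := oddRows.flatten

theorem oddProd_eq : oddProd = oddList.prod := by decide +kernel

theorem primeProd_eq : primeProd = oddProd * otherPrimes.prod := by decide +kernel

theorem oddList_lt : ∀ r ∈ oddList, r < 2000 ∧ 2 < r := by decide +kernel

theorem otherPrimes_lt : ∀ r ∈ otherPrimes, r ≤ 3623 := by decide +kernel

theorem oddList_sq : ∀ r ∈ oddList, ¬ r * r ∣ oddProd := by decide +kernel

/-- Trial division by the primes up to `61`. -/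
noncomputable def hasDiv (x : ℕ) : Bool :=
  @List.rec ℕ (fun _ => Bool) false
    (fun d _ ih => @Bool.rec (fun _ => Bool) ih (Nat.ble (Nat.add d (nat_lit 1)) x)
      (Nat.beq (Nat.mod x d) (nat_lit 0)))
    [nat_lit 2, nat_lit 3, nat_lit 5, nat_lit 7, nat_lit 11, nat_lit 13, nat_lit 17, nat_lit 19,
      nat_lit 23, nat_lit 29, nat_lit 31, nat_lit 37, nat_lit 41, nat_lit 43, nat_lit 47,
      nat_lit 53, nat_lit 59, nat_lit 61]

theorem hasDiv_spec {x : ℕ} (h : hasDiv x = true) : ¬ x.Prime := by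
  intro hp
  unfold hasDiv at h
  generalize hL : [2, 3, 5, 7, 11, 13, 17, 19, 23, 29, 31, 37, 41, 43, 47, 53, 59, 61] = L at h
  have hL1 : ∀ d ∈ L, 1 < d := by
    rw [← hL]; decide
  clear hL
  induction L with
  | nil => exact absurd h (by simp)
  | cons d L ih =>
    cases hd : Nat.beq (x % d) 0 with
    | false =>
      refine ih ?_ (fun e he => hL1 e (by simp [he]))
      have h1 : @Bool.rec (fun _ => Bool) _ (Nat.ble (d + 1) x) (Nat.beq (x % d) 0) = true := h
      rw [hd] at h1
      exact h1
    | true =>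
      have h1 : @Bool.rec (fun _ => Bool) _ (Nat.ble (d + 1) x) (Nat.beq (x % d) 0) = true := h
      rw [hd] at h1
      have h2 : d + 1 ≤ x := Nat.ble_eq.mp h1
      have h3 := Nat.dvd_of_mod_eq_zero (Nat.eq_of_beq_eq_true hd)
      have h4 := hL1 d (by simp)
      rcases (Nat.dvd_prime hp).mp h3 with h5 | h5 <;> omega

/-- The table look-up for `primeProd`. -/
noncomputable def primeChk (x : ℕ) : Bool :=
  bOr (Nat.ble x (nat_lit 1)) (bOr (hasDiv x) (bAnd (Nat.beq (Nat.mod primeProd x) (nat_lit 0))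
    (Nat.ble (nat_lit 1) (Nat.mod (Nat.div primeProd x) x))))

/-- List membership. -/
noncomputable def isMem (x : ℕ) (L : List ℕ) : Bool :=
  @List.rec ℕ (fun _ => Bool) false
    (fun d _ ih => @Bool.rec (fun _ => Bool) ih true (Nat.beq x d)) L

theorem isMem_spec {x : ℕ} {L : List ℕ} (h : isMem x L = true) : x ∈ L := by
  induction L with
  | nil => exact absurd h (by simp [isMem])
  | cons d L ih =>
    have h1 : @Bool.rec (fun _ => Bool) (isMem x L) true (Nat.beq x d) = true := h
    cases hd : Nat.beq x d with
    | true => rw [Nat.eq_of_beq_eq_true hd]; simp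
    | false => rw [hd] at h1; exact List.mem_cons_of_mem d (ih h1)

/-- The table look-up for `oddList`. -/
noncomputable def oddChk (x : ℕ) : Bool :=
  bOr (Nat.ble x (nat_lit 2)) (bOr (hasDiv x) (isMem x oddList))

theorem prime_run : chunk (fun x d => upTo (fun k => primeChk (Nat.add x (Nat.mul (nat_lit 1) k))) d)
    (nat_lit 0) (nat_lit 1) (nat_lit 60) (nat_lit 3624) = true := by decide +kernel

theorem odd_run : chunk (fun x d => upTo (fun k => oddChk (Nat.add x (Nat.mul (nat_lit 1) k))) d)
    (nat_lit 0) (nat_lit 1) (nat_lit 60) (nat_lit 2000) = true := by decide +kernel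

theorem prime_tab (x : ℕ) (hx : x < 3624) : x < 2 ∨ hasDiv x = true ∨
    (primeProd % x = 0 ∧ primeProd / x % x ≠ 0) := by
  have h := chunk_spec (fun x => primeChk x = true) (by norm_num)
    (fun e d he k hk => upTo_spec he k hk) prime_run x hx
  have h1 : primeChk x = true := by
    rw [show x = 0 + 1 * x by omega]
    exact h
  unfold primeChk at h1
  rw [bOr_true, bOr_true, bAnd_true] at h1
  rcases h1 with h1 | h1 | ⟨h1, h2⟩
  · exact Or.inl (Nat.lt_succ_of_le (Nat.ble_eq.mp h1))
  · exact Or.inr (Or.inl h1)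
  · exact Or.inr (Or.inr ⟨Nat.eq_of_beq_eq_true h1, (Nat.pos_iff_ne_zero.mp (Nat.ble_eq.mp h2))⟩)

theorem odd_tab (x : ℕ) (hx : x < 2000) : x < 3 ∨ hasDiv x = true ∨ x ∈ oddList := by
  have h := chunk_spec (fun x => oddChk x = true) (by norm_num)
    (fun e d he k hk => upTo_spec he k hk) odd_run x hx
  have h1 : oddChk x = true := by
    rw [show x = 0 + 1 * x by omega]
    exact h
  unfold oddChk at h1
  rw [bOr_true, bOr_true] at h1
  rcases h1 with h1 | h1 | h1
  · exact Or.inl (Nat.lt_succ_of_le (Nat.ble_eq.mp h1))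
  · exact Or.inr (Or.inl h1)
  · exact Or.inr (Or.inr (isMem_spec h1))

theorem mem_oddList {p : ℕ} (hp : p.Prime) (h2 : p ≠ 2) (h : p < 2000) : p ∈ oddList := by
  rcases odd_tab p h with h1 | h1 | h1
  · have := hp.two_le; omega
  · exact absurd hp (hasDiv_spec h1)
  · exact h1

theorem dvd_primeProd {p : ℕ} (hp : p.Prime) (h : p < 3624) :
    p ∣ primeProd ∧ ¬ p * p ∣ primeProd := by
  rcases prime_tab p h with h1 | h1 | h1
  · have := hp.two_le; omega
  · exact absurd hp (hasDiv_spec h1)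
  · refine ⟨Nat.dvd_of_mod_eq_zero h1.1, fun h3 => h1.2 ?_⟩
    apply Nat.mod_eq_zero_of_dvd
    exact Nat.dvd_div_of_mul_dvd h3

theorem not_dvd_oddProd {p : ℕ} (hp : p.Prime) (h : 2000 ≤ p) : ¬ p ∣ oddProd := by
  rw [oddProd_eq]
  intro h1
  obtain ⟨a, ha, h2⟩ := (hp.prime.dvd_prod_iff).mp h1
  have h3 := oddList_lt a ha
  have := Nat.le_of_dvd (by omega) h2
  omega

theorem otherPrimes_pos : ∀ r ∈ otherPrimes, 0 < r := by decide +kernel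

theorem not_dvd_primeProd {p : ℕ} (hp : p.Prime) (h : 3624 ≤ p) : ¬ p ∣ primeProd := by
  rw [primeProd_eq]
  intro h1
  rcases hp.dvd_mul.mp h1 with h1 | h1
  · exact not_dvd_oddProd hp (by omega) h1
  obtain ⟨a, ha, h2⟩ := (hp.prime.dvd_prod_iff).mp h1
  have h3 := otherPrimes_lt a ha
  have := Nat.le_of_dvd (otherPrimes_pos a ha) h2
  omega

theorem gcd_mod_self (n S : ℕ) : Nat.gcd n (S % n) = Nat.gcd n S := by
  rw [Nat.gcd_comm n (S % n), ← Nat.gcd_rec]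

theorem tS_eq (n : ℕ) : tS n = Nat.beq (Nat.gcd (n / Nat.gcd n (oddProd % n))
    (Nat.gcd n (oddProd % n))) 1 := rfl

theorem tS_spec {n r : ℕ} (h : tS n = true) (hp : r.Prime) (hr : r ∈ oddList) :
    ¬ r * r ∣ n := by
  rw [tS_eq, gcd_mod_self] at h
  refine dvd_of_test hp ?_ (oddList_sq r hr) (Nat.eq_of_beq_eq_true h)
  rw [oddProd_eq]
  exact List.dvd_prod hr

/-- The limit below which `sf` is valid. -/
theorem squarefree_core {n : ℕ} (hn : n ≠ 0) (hlt : n < 47300000000)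
    (h : Nat.gcd (n / Nat.gcd n primeProd) (Nat.gcd n primeProd) = 1)
    (hs : ∀ r, 1 < r → n / Nat.gcd n primeProd ≠ r * r) : Squarefree n := by
  rw [Nat.squarefree_iff_prime_squarefree]
  intro r hp hd
  rcases lt_or_ge r 3624 with hr | hr
  · exact dvd_of_test hp (dvd_primeProd hp hr).1 (dvd_primeProd hp hr).2 h hd
  · have hn' : n = Nat.gcd n primeProd * (n / Nat.gcd n primeProd) :=
      (Nat.mul_div_cancel' (Nat.gcd_dvd_left n primeProd)).symm
    have hcop : Nat.Coprime (r * r) (Nat.gcd n primeProd) := by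
      have h1 : Nat.Coprime r (Nat.gcd n primeProd) := by
        rw [Nat.Prime.coprime_iff_not_dvd hp]
        intro h2
        exact not_dvd_primeProd hp hr (dvd_trans h2 (Nat.gcd_dvd_right _ _))
      exact Nat.Coprime.mul_left h1 h1
    have h1 : r * r ∣ n / Nat.gcd n primeProd := by
      rw [hn'] at hd
      exact hcop.dvd_of_dvd_mul_left hd
    obtain ⟨e, he⟩ := h1
    have hle : n / Nat.gcd n primeProd ≤ n := Nat.div_le_self _ _
    have hrr : 3624 * 3624 ≤ r * r := Nat.mul_le_mul hr hr
    by_cases he1 : e = 1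
    · exact hs r hp.one_lt (by rw [he, he1, mul_one])
    · have hs' := Nat.minFac_prime he1
      have he0 : 0 < e := by
        rcases Nat.eq_zero_or_pos e with h0 | h0
        · rw [h0, mul_zero] at he
          rw [he, mul_zero] at hn'
          exact absurd hn' hn
        · exact h0
      have hlt' : e < 3624 := by
        by_contra hc
        have : 3624 * 3624 * 3624 ≤ r * r * e := Nat.mul_le_mul hrr (by omega)
        omega
      have h2 : e.minFac < 3624 := lt_of_le_of_lt (Nat.minFac_le he0) hlt'
      have h3 : e.minFac ∣ n / Nat.gcd n primeProd := by
        rw [he]; exact dvd_trans (Nat.minFac_dvd e) (dvd_mul_left _ _)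
      have h4 : e.minFac ∣ n := dvd_trans h3 (Nat.div_dvd_of_dvd (Nat.gcd_dvd_left _ _))
      have h5 := Nat.dvd_gcd h3 (Nat.dvd_gcd h4 (dvd_primeProd hs' h2).1)
      rw [h] at h5
      exact hs'.one_lt.ne' (Nat.dvd_one.mp h5)

theorem sqBit_tab : ∀ y < 840, sqBit (y * y) = 1 := by decide +kernel
theorem sqBitB_tab : ∀ y < 143, sqBitB (y * y) = 1 := by decide +kernel
theorem sqBitC_tab : ∀ y < 323, sqBitC (y * y) = 1 := by decide +kernel

theorem sqBit_mod (c : ℕ) : sqBit (c % 840) = sqBit c := by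
  show Nat.land _ (Nat.shiftRight _ ((c % 840) % 840)) = Nat.land _ (Nat.shiftRight _ (c % 840))
  rw [Nat.mod_mod]

theorem sqBitB_mod (c : ℕ) : sqBitB (c % 143) = sqBitB c := by
  show Nat.land _ (Nat.shiftRight _ ((c % 143) % 143)) = Nat.land _ (Nat.shiftRight _ (c % 143))
  rw [Nat.mod_mod]

theorem sqBitC_mod (c : ℕ) : sqBitC (c % 323) = sqBitC c := by
  show Nat.land _ (Nat.shiftRight _ ((c % 323) % 323)) = Nat.land _ (Nat.shiftRight _ (c % 323))
  rw [Nat.mod_mod]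

theorem sqBit_sq (r : ℕ) : sqBit (r * r) = 1 := by
  rw [← sqBit_mod, Nat.mul_mod, sqBit_mod]
  exact sqBit_tab _ (Nat.mod_lt _ (by norm_num))

theorem sqBitB_sq (r : ℕ) : sqBitB (r * r) = 1 := by
  rw [← sqBitB_mod, Nat.mul_mod, sqBitB_mod]
  exact sqBitB_tab _ (Nat.mod_lt _ (by norm_num))

theorem sqBitC_sq (r : ℕ) : sqBitC (r * r) = 1 := by
  rw [← sqBitC_mod, Nat.mul_mod, sqBitC_mod]
  exact sqBitC_tab _ (Nat.mod_lt _ (by norm_num))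

theorem sf_eq (n : ℕ) : sf n = Nat.beq (Nat.gcd (n / Nat.gcd n (primeProd % n))
    (Nat.gcd n (primeProd % n)) + sqBit (n / Nat.gcd n (primeProd % n))) 1 := rfl

theorem sfx_eq (n : ℕ) : sfx n = bAnd (Nat.beq (Nat.gcd (n / Nat.gcd n (primeProd % n))
    (Nat.gcd n (primeProd % n))) 1) (bOr (Nat.beq (sqBit (n / Nat.gcd n (primeProd % n))) 0)
      (bOr (Nat.beq (n / Nat.gcd n (primeProd % n)) 1)
        (bOr (Nat.beq (sqBitB (n / Nat.gcd n (primeProd % n))) 0)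
          (Nat.beq (sqBitC (n / Nat.gcd n (primeProd % n))) 0)))) := rfl

theorem sf_spec {n : ℕ} (hlt : n < 47300000000) (h : sf n = true) : Squarefree n := by
  rcases Nat.eq_zero_or_pos n with rfl | hn
  · exact absurd h (by decide +kernel)
  rw [sf_eq, gcd_mod_self] at h
  have h1 := Nat.eq_of_beq_eq_true h
  have hg : 0 < Nat.gcd (n / Nat.gcd n primeProd) (Nat.gcd n primeProd) :=
    Nat.gcd_pos_of_pos_right _ (Nat.gcd_pos_of_pos_left _ hn)
  refine squarefree_core hn.ne' hlt (by omega) ?_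
  intro r _ hr
  have h2 := sqBit_sq r
  rw [← hr] at h2
  omega

theorem sfx_spec {n : ℕ} (hlt : n < 47300000000) (h : sfx n = true) : Squarefree n := by
  rcases Nat.eq_zero_or_pos n with rfl | hn
  · exact absurd h (by decide +kernel)
  rw [sfx_eq, gcd_mod_self, bAnd_true, bOr_true, bOr_true, bOr_true] at h
  obtain ⟨h1, h2⟩ := h
  refine squarefree_core hn.ne' hlt (Nat.eq_of_beq_eq_true h1) ?_
  intro r hr1 hr
  rw [hr] at h2
  have a1 := sqBit_sq r
  have a2 := sqBitB_sq r
  have a3 := sqBitC_sq r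
  rcases h2 with h2 | h2 | h2 | h2 <;> have h3 := Nat.eq_of_beq_eq_true h2
  · omega
  · nlinarith
  · omega
  · omega

/-! ### The conditions on a block -/

/-- The condition on the positions next to the block `b + 1, …, b + 7`. -/
def EdgeBad (b : ℕ) : Prop :=
  ¬ Squarefree (b + 9) ∧ ((¬ Squarefree (b - 2) ∧ ¬ Squarefree (b - 1)) ∨
    (¬ Squarefree (b - 1) ∧ ¬ Squarefree (b + 10)) ∨
    (¬ Squarefree (b + 10) ∧ ¬ Squarefree (b + 11)))

/-- The full condition on a block. -/
def Bad (b : ℕ) : Prop :=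
  (¬ Squarefree (b + 1) ∧ ¬ Squarefree (b + 2) ∧ ¬ Squarefree (b + 3)) ∧
    (¬ Squarefree (b + 5) ∧ ¬ Squarefree (b + 6) ∧ ¬ Squarefree (b + 7)) ∧ EdgeBad b

theorem topZ_eq : topZ = 47255689912 := rfl

theorem edge_eq (b : ℕ) : edge b = bOr (sfx (b + 9)) (bAnd (bOr (sfx (b - 1))
    (bAnd (sfx (b - 2)) (sfx (b + 10)))) (bOr (sfx (b + 10)) (sfx (b + 11)))) := rfl

theorem edge_spec {b : ℕ} (hb : b ≤ topZ) (h : edge b = true) : ¬ EdgeBad b := by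
  rw [topZ_eq] at hb
  rintro ⟨h9, hc⟩
  rw [edge_eq, bOr_true, bAnd_true, bOr_true, bAnd_true, bOr_true] at h
  have s1 := @sfx_spec (b - 1) (by omega)
  have s2 := @sfx_spec (b - 2) (by omega)
  have s9 := @sfx_spec (b + 9) (by omega)
  have s10 := @sfx_spec (b + 10) (by omega)
  have s11 := @sfx_spec (b + 11) (by omega)
  tauto

theorem fallb_eq (t : ℕ) : fallb t = bAnd
    (bOr (sfx (t + 5)) (bOr (sfx (t + 6)) (bOr (sfx (t + 7)) (edge t))))
    (bOr (sfx (t - 3)) (bOr (sfx (t - 2)) (bOr (sfx (t - 1)) (edge (t - 4))))) := rfl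

theorem fallb_spec {t : ℕ} (ht : t ≤ topZ) (h : fallb t = true) :
    ¬ Bad t ∧ ∀ b, b + 4 = t → ¬ Bad b := by
  have ht' := ht
  rw [topZ_eq] at ht
  rw [fallb_eq, bAnd_true, bOr_true, bOr_true, bOr_true, bOr_true, bOr_true, bOr_true] at h
  obtain ⟨h1, h2⟩ := h
  constructor
  · rintro ⟨-, ⟨h5, h6, h7⟩, he⟩
    rcases h1 with h1 | h1 | h1 | h1
    · exact h5 (sfx_spec (by omega) h1)
    · exact h6 (sfx_spec (by omega) h1)
    · exact h7 (sfx_spec (by omega) h1)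
    · exact edge_spec ht' h1 he
  · rintro b rfl ⟨⟨h5, h6, h7⟩, -, he⟩
    rcases h2 with h2 | h2 | h2 | h2
    · exact h5 (sfx_spec (by omega) h2)
    · exact h6 (sfx_spec (by omega) h2)
    · exact h7 (sfx_spec (by omega) h2)
    · exact edge_spec (by omega) h2 he

/-! ### Large primes -/

/-- What the large prime computation shows for the triple after `t`, at positions `v`, `w`. -/
def Triple (v w t : ℕ) : Prop :=
  t ≤ topZ → Squarefree (t + v) ∨ Squarefree (t + w) ∨ (¬ Bad t ∧ ∀ b, b + 4 = t → ¬ Bad b)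

theorem bigLoop_spec {m v w e d : ℕ} (hv : v ≤ 3) (hw : w ≤ 3) (h : bigLoop m v w e d = true) :
    ∀ k < d, Triple v w (e + m * k) := by
  induction d with
  | zero => intro k hk; omega
  | succ d ih =>
    have h1 : @Bool.rec (fun _ => Bool) (@Bool.rec (fun _ => Bool)
        (@Bool.rec (fun _ => Bool) false (bigLoop m v w e d) (fallb (e + m * d)))
        (bigLoop m v w e d) (sf (e + m * d + w)))
      (bigLoop m v w e d) (sf (e + m * d + v)) = true := h
    have h2 : bigLoop m v w e d = true ∧ Triple v w (e + m * d) := by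
      cases hf : sf (e + m * d + v) with
      | true =>
        rw [hf] at h1
        refine ⟨h1, fun ht => Or.inl (sf_spec ?_ hf)⟩
        rw [topZ_eq] at ht; omega
      | false =>
        rw [hf] at h1
        cases hg : sf (e + m * d + w) with
        | true =>
          rw [hg] at h1
          refine ⟨h1, fun ht => Or.inr (Or.inl (sf_spec ?_ hg))⟩
          rw [topZ_eq] at ht; omega
        | false =>
          rw [hg] at h1
          cases hh : fallb (e + m * d) with
          | true =>
            rw [hh] at h1
            exact ⟨h1, fun ht => Or.inr (Or.inr (fallb_spec ht hh))⟩
          | false =>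
            rw [hh] at h1
            exact absurd h1 (by simp)
    intro k hk
    rcases Nat.lt_succ_iff_lt_or_eq.mp hk with hk | rfl
    · exact ih h2.1 k hk
    · exact h2.2

theorem bigPos_spec {e m v w : ℕ} (hm : 0 < m) (hv : v ≤ 3) (hw : w ≤ 3)
    (h : bigPos e m v w = true) (k : ℕ) : Triple v w (e + m * k) := by
  intro ht
  have h1 : @Bool.rec (fun _ => Bool) true
    (chunk (fun eNew d => bigLoop m v w eNew d) e m 40 ((topZ - e) / m + 1)) (Nat.ble e topZ)
      = true := h
  have h2 : Nat.ble e topZ = true := Nat.ble_eq.mpr (le_trans (Nat.le_add_right _ _) ht)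
  rw [h2] at h1
  refine chunk_spec (Triple v w) (by norm_num) (fun e d he => bigLoop_spec hv hw he) h1 k ?_ ht
  apply Nat.lt_succ_of_le
  rw [Nat.le_div_iff_mul_le hm, mul_comm]
  omega

theorem bigSq_eq (q : ℕ) : bigSq q = bAnd (bigPos (q - 1) (4 * q) 2 3)
    (bAnd (bigPos (2 * q - 2) (4 * q) 1 3) (bigPos (3 * q - 3) (4 * q) 1 2)) := rfl

theorem bigOne_eq (p : ℕ) : bigOne p = @Bool.rec (fun _ => Bool) true (bigSq (p * p))
    (Nat.beq (Nat.gcd p oddProd) 1) := rfl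

/-- Conclusion of the large prime case for `p`. -/
theorem bigOne_spec {p : ℕ} (hp : p.Prime) (h2 : 2000 ≤ p) (h : bigOne p = true) {t w : ℕ}
    (ht : t ≤ topZ) (ht4 : t % 4 = 0) (hw : w = 1 ∨ w = 2 ∨ w = 3) (hd : p * p ∣ t + w)
    (hs : ¬ Squarefree (t + 1) ∧ ¬ Squarefree (t + 2) ∧ ¬ Squarefree (t + 3)) :
    ¬ Bad t ∧ ∀ b, b + 4 = t → ¬ Bad b := by
  have hc : Nat.gcd p oddProd = 1 :=
    (Nat.Prime.coprime_iff_not_dvd hp).mpr (not_dvd_oddProd hp h2)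
  rw [bigOne_eq, hc] at h
  have h3 : bigSq (p * p) = true := h
  rw [bigSq_eq, bAnd_true, bAnd_true] at h3
  obtain ⟨ha, hb, hc⟩ := h3
  have hodd : p % 2 = 1 := hp.eq_two_or_odd.resolve_left (by omega)
  have hq : p * p % 4 = 1 := by
    have : p % 4 = 1 ∨ p % 4 = 3 := by omega
    rcases this with h | h <;> simp [Nat.mul_mod, h]
  have hq0 : 0 < p * p := Nat.mul_pos hp.pos hp.pos
  generalize p * p = q at *
  obtain ⟨s, hs'⟩ := hd
  have hs4 : s % 4 = w := by
    have h5 : (q * s) % 4 = s % 4 := by rw [Nat.mul_mod, hq, one_mul, Nat.mod_mod]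
    rw [← hs'] at h5
    omega
  have hs5 : s = w + 4 * (s / 4) := by omega
  have hs6 : t + w = q * w + 4 * q * (s / 4) := by
    rw [hs']; conv_lhs => rw [hs5]
    ring
  rcases hw with rfl | rfl | rfl
  · have := bigPos_spec (by omega) (by norm_num) (by norm_num) ha (s / 4)
    rw [show q - 1 + 4 * q * (s / 4) = t by omega] at this
    have := this ht
    tauto
  · have := bigPos_spec (by omega) (by norm_num) (by norm_num) hb (s / 4)
    rw [show 2 * q - 2 + 4 * q * (s / 4) = t by omega] at this
    have := this ht
    tauto
  · have := bigPos_spec (by omega) (by norm_num) (by norm_num) hc (s / 4)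
    rw [show 3 * q - 3 + 4 * q * (s / 4) = t by omega] at this
    have := this ht
    tauto

theorem bigRange_spec {p₀ D : ℕ} (h : bigRange p₀ D = true) (p : ℕ) (hodd : p % 2 = 1)
    (hodd' : p₀ % 2 = 1) (h1 : p₀ ≤ p) (h2 : p < p₀ + 2 * D) : bigOne p = true := by
  have h3 := chunk_spec (fun p => bigOne p = true) (by norm_num)
    (fun e d he k hk => upTo_spec he k hk) h ((p - p₀) / 2) (by omega)
  have h4 : p₀ + 2 * ((p - p₀) / 2) = p := by omega
  rw [← h4]
  exact h3

/-! ### Small primes -/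

/-- `n` is divisible by the square of an odd prime below `2000`. -/
def SmallSq (n : ℕ) : Prop := ∃ r, r.Prime ∧ r ∈ oddList ∧ r * r ∣ n

/-- Hypotheses at a node of the search. -/
def Node (U : List ℕ) (M a b : ℕ) : Prop :=
  0 < M ∧ b ≤ topZ ∧ b % M = a ∧ (∀ r, r.Prime → r ∈ oddList → r ∣ M → ∀ u ∈ U, ¬ r * r ∣ b + u) ∧
    (∀ u ∈ U, SmallSq (b + u)) ∧ EdgeBad b

/-- The node contains no solution. -/
def Good (U : List ℕ) (M a : ℕ) : Prop := ∀ b, ¬ Node U M a b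

/-- The branch `r` at position `u` contains no solution. -/
def StepGood (U : List ℕ) (u M a r : ℕ) : Prop :=
  ∀ b, Node (u :: U) M a b → ¬ (r.Prime ∧ r ∈ oddList ∧ r * r ∣ b + u)

theorem tS_small {n : ℕ} (h : tS n = true) : ¬ SmallSq n := by
  rintro ⟨r, hp, hr, hd⟩
  exact tS_spec h hp hr hd

theorem leafChk_spec {U : List ℕ} {b : ℕ} (hb : b ≤ topZ) (h : leafChk U b = true)
    (hU : ∀ u ∈ U, SmallSq (b + u)) : ¬ EdgeBad b := by
  induction U with
  | nil => exact edge_spec hb h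
  | cons u U ih =>
    have h1 : @Bool.rec (fun _ => Bool) (leafChk U b) true (tS (b + u)) = true := h
    cases ht : tS (b + u) with
    | true => exact absurd (hU u (by simp)) (tS_small ht)
    | false =>
      rw [ht] at h1
      exact ih h1 (fun v hv => hU v (by simp [hv]))

theorem leafLoop_spec {U : List ℕ} {u M a d : ℕ} (h : leafLoop U u M a d = true) :
    ∀ k < d, (a + M * k ≤ topZ → (∀ v ∈ u :: U, SmallSq (a + M * k + v)) →
      ¬ EdgeBad (a + M * k)) := by
  induction d with
  | zero => intro k hk; omega
  | succ d ih =>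
    have h1 : @Bool.rec (fun _ => Bool)
        (@Bool.rec (fun _ => Bool) false (leafLoop U u M a d) (leafChk U (a + M * d)))
      (leafLoop U u M a d) (tS (a + M * d + u)) = true := h
    have h2 : leafLoop U u M a d = true ∧ (a + M * d ≤ topZ →
        (∀ v ∈ u :: U, SmallSq (a + M * d + v)) → ¬ EdgeBad (a + M * d)) := by
      cases hf : tS (a + M * d + u) with
      | true =>
        rw [hf] at h1
        exact ⟨h1, fun _ hU => absurd (hU u (by simp)) (tS_small hf)⟩
      | false =>
        rw [hf] at h1
        cases hg : leafChk U (a + M * d) with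
        | true =>
          rw [hg] at h1
          exact ⟨h1, fun hb hU => leafChk_spec hb hg (fun v hv => hU v (by simp [hv]))⟩
        | false =>
          rw [hg] at h1
          exact absurd h1 (by simp)
    intro k hk
    rcases Nat.lt_succ_iff_lt_or_eq.mp hk with hk | rfl
    · exact ih h2.1 k hk
    · exact h2.2

theorem leaf_spec {U : List ℕ} {u M a : ℕ}
    (h : chunk (fun aNew d => leafLoop U u M aNew d) a M 40 ((topZ - a) / M + 1) = true) :
    Good (u :: U) M a := by
  rintro b ⟨hM, hb, hba, -, hU, he⟩
  have h1 := Nat.div_add_mod b M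
  have h2 : a + M * (b / M) = b := by omega
  have h3 := chunk_spec (fun b => b ≤ topZ → (∀ v ∈ u :: U, SmallSq (b + v)) → ¬ EdgeBad b)
    (by norm_num) (fun e d he => leafLoop_spec he) h (b / M) (by
      apply Nat.lt_succ_of_le
      rw [Nat.le_div_iff_mul_le hM, mul_comm]
      omega)
  rw [h2] at h3
  exact h3 hb hU he

theorem node_child {U : List ℕ} {u M a r k b : ℕ} (hlt : ∀ v ∈ U, v ≠ u ∧ v < u + 9 ∧ u < v + 9)
    (hM : ¬ r ∣ M) (hk : k < r * r) (hq : (a + M * k + u) % (r * r) = 0)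
    (hp : r.Prime) (h2 : 2 < r) (hr : r * r ∣ b + u)
    (hn : Node (u :: U) M a b) : Node U (M * (r * r)) (a + M * k) b := by
  obtain ⟨hM0, hb, hba, hinv, hU, he⟩ := hn
  refine ⟨Nat.mul_pos hM0 (Nat.mul_pos hp.pos hp.pos), hb, ?_, ?_, ?_, he⟩
  · have hcop : Nat.Coprime M (r * r) := by
      have h1 : Nat.Coprime r M := (Nat.Prime.coprime_iff_not_dvd hp).mpr hM
      exact Nat.Coprime.mul_right h1.symm h1.symm
    have h1 : b ≡ a + M * k [MOD M] := by
      have : a + M * k ≡ a [MOD M] := by simp [Nat.ModEq]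
      refine Nat.ModEq.trans ?_ this.symm
      rw [← hba]
      exact (Nat.mod_modEq b M).symm
    have h3 : b ≡ a + M * k [MOD (r * r)] := by
      apply Nat.ModEq.add_right_cancel' u
      exact (Nat.mod_eq_zero_of_dvd hr).trans hq.symm
    have h4 := (Nat.modEq_and_modEq_iff_modEq_mul hcop).mp ⟨h1, h3⟩
    have h5 : a < M := hba ▸ Nat.mod_lt b hM0
    have h6 : a + M * k < M * (r * r) := by
      calc a + M * k < M + M * k := by omega
        _ = M * (k + 1) := by ring
        _ ≤ M * (r * r) := Nat.mul_le_mul_left M hk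
    rw [Nat.ModEq, Nat.mod_eq_of_lt h6] at h4
    exact h4
  · intro s hs hs' hsM v hv hd
    rcases hs.dvd_mul.mp hsM with h1 | h1
    · exact hinv s hs hs' h1 v (by simp [hv]) hd
    · have h3 : s = r := by
        rcases hs.dvd_mul.mp h1 with h1 | h1 <;> exact (Nat.prime_dvd_prime_iff_eq hs hp).mp h1
      subst h3
      obtain ⟨h4, h5, h6⟩ := hlt v hv
      have h9 : 3 * 3 ≤ s * s := Nat.mul_le_mul h2 h2
      rcases Nat.lt_or_gt_of_ne h4 with h7 | h7
      · have h8 := (Nat.dvd_sub hr hd)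
        have := Nat.le_of_dvd (by omega) h8
        omega
      · have h8 := (Nat.dvd_sub hd hr)
        have := Nat.le_of_dvd (by omega) h8
        omega
  · intro v hv
    exact hU v (by simp [hv])

theorem stepGood_of_good {U : List ℕ} {u M a r k : ℕ}
    (hlt : ∀ v ∈ U, v ≠ u ∧ v < u + 9 ∧ u < v + 9)
    (hM : ¬ r ∣ M) (hk : k < r * r) (hq : (a + M * k + u) % (r * r) = 0) (h2 : 2 < r)
    (h : topZ < a + M * k ∨ Good U (M * (r * r)) (a + M * k)) : StepGood U u M a r := by
  rintro b hn ⟨hp, -, hd⟩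
  have h1 := node_child hlt hM hk hq hp h2 hd hn
  rcases h with h | h
  · obtain ⟨-, hb, hba, -⟩ := h1
    have := Nat.mod_le b (M * (r * r))
    omega
  · exact h b h1

theorem good_of_steps {U : List ℕ} {u M a : ℕ} (h : ∀ r ∈ oddList, StepGood U u M a r) :
    Good (u :: U) M a := by
  intro b hn
  obtain ⟨r, hp, hr, hd⟩ := hn.2.2.2.2.1 u (by simp)
  exact h r hr b hn ⟨hp, hr, hd⟩

theorem crt_form (u M a r : ℕ) (hr : 0 < r) : ∃ k < r * r, crt u M a r = a + M * k :=
  ⟨_, Nat.mod_lt _ (Nat.mul_pos hr hr), rfl⟩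

theorem step_spec {U : List ℕ} {cont : ℕ → ℕ → Bool} {u M a r : ℕ}
    (hc : ∀ M a, cont M a = true → Good U M a)
    (hlt : ∀ v ∈ U, v ≠ u ∧ v < u + 9 ∧ u < v + 9) (h2 : 2 < r)
    (h : step cont u M a r = true) : StepGood U u M a r := by
  have h1 : @Bool.rec (fun _ => Bool) (stepAux cont u M r (crt u M a r)) true
    (Nat.beq (M % r) 0) = true := h
  cases hM : Nat.beq (M % r) 0 with
  | true =>
    have h3 : r ∣ M := Nat.dvd_of_mod_eq_zero (Nat.eq_of_beq_eq_true hM)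
    rintro b hn ⟨hp, hr, hd⟩
    exact hn.2.2.2.1 r hp hr h3 u (by simp) hd
  | false =>
    rw [hM] at h1
    have hM' : ¬ r ∣ M := fun hd => by
      have := Nat.mod_eq_zero_of_dvd hd
      rw [this] at hM
      exact absurd hM (by simp)
    obtain ⟨k, hk, hk'⟩ := crt_form u M a r (by omega)
    rw [hk'] at h1
    have h3 : @Bool.rec (fun _ => Bool)
      (@Bool.rec (fun _ => Bool) false (cont (M * (r * r)) (a + M * k))
        (Nat.beq ((a + M * k + u) % (r * r)) 0))
      (Nat.beq ((a + M * k + u) % (r * r)) 0) (Nat.ble (topZ + 1) (a + M * k)) = true := h1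
    cases hz : Nat.ble (topZ + 1) (a + M * k) with
    | true =>
      rw [hz] at h3
      exact stepGood_of_good hlt hM' hk (Nat.eq_of_beq_eq_true h3) h2 (Or.inl (Nat.ble_eq.mp hz))
    | false =>
      rw [hz] at h3
      cases hq : Nat.beq ((a + M * k + u) % (r * r)) 0 with
      | true =>
        rw [hq] at h3
        exact stepGood_of_good hlt hM' hk (Nat.eq_of_beq_eq_true hq) h2 (Or.inr (hc _ _ h3))
      | false =>
        rw [hq] at h3
        exact absurd h3 (by simp)

theorem branch_spec {cont : ℕ → ℕ → Bool} {u M a : ℕ} {L : List ℕ}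
    (h : branch cont u M a L = true) : ∀ r ∈ L, step cont u M a r = true := by
  induction L with
  | nil => intro r hr; simp at hr
  | cons s L ih =>
    have h1 : @Bool.rec (fun _ => Bool) false (branch cont u M a L) (step cont u M a s) = true := h
    cases hs : step cont u M a s with
    | false => rw [hs] at h1; exact absurd h1 (by simp)
    | true =>
      rw [hs] at h1
      intro r hr
      rcases List.mem_cons.mp hr with rfl | hr
      · exact hs
      · exact ih h1 r hr

theorem branches_spec {cont : ℕ → ℕ → Bool} {u M a : ℕ} {LL : List (List ℕ)}
    (h : branches cont u M a LL = true) : ∀ r ∈ LL.flatten, step cont u M a r = true := by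
  induction LL with
  | nil => intro r hr; simp at hr
  | cons L LL ih =>
    have h1 : @Bool.rec (fun _ => Bool) false (branches cont u M a LL) (branch cont u M a L)
      = true := h
    cases hs : branch cont u M a L with
    | false => rw [hs] at h1; exact absurd h1 (by simp)
    | true =>
      rw [hs] at h1
      intro r hr
      rw [List.flatten_cons, List.mem_append] at hr
      rcases hr with hr | hr
      · exact branch_spec hs r hr
      · exact ih h1 r hr

theorem dfs_spec {U : List ℕ} (hlt : U.Pairwise (fun u v => v ≠ u ∧ v < u + 9 ∧ u < v + 9)) :
    ∀ M a, dfs U M a = true → Good U M a := by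
  induction U with
  | nil => intro M a h; exact absurd (show false = true from h) (by simp)
  | cons u U ih =>
    intro M a h
    rw [List.pairwise_cons] at hlt
    have h1 : @Bool.rec (fun _ => Bool) (branches (dfs U) u M a oddRows)
      (chunk (fun aNew d => leafLoop U u M aNew d) a M 40 ((topZ - a) / M + 1))
      (Nat.ble topZ (1000 * M)) = true := h
    cases hT : Nat.ble topZ (1000 * M) with
    | true => rw [hT] at h1; exact leaf_spec h1
    | false =>
      rw [hT] at h1
      apply good_of_steps
      intro r hr
      exact step_spec (ih hlt.2) hlt.1 (oddList_lt r hr).2 (branches_spec h1 r hr)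

/-- Combining the parts of a computation at a node. -/
theorem part_spec {U : List ℕ} {u M a : ℕ} {LL : List (List ℕ)}
    (hlt : (u :: U).Pairwise (fun u v => v ≠ u ∧ v < u + 9 ∧ u < v + 9))
    (h : branches (dfs U) u M a LL = true) :
    ∀ r ∈ LL.flatten, r ∈ oddList → StepGood U u M a r := by
  rw [List.pairwise_cons] at hlt
  intro r hr hr'
  exact step_spec (dfs_spec hlt.2) hlt.1 (oddList_lt r hr').2 (branches_spec h r hr)

/-! ### Computations -/

theorem big_2001 : bigRange (nat_lit 2001) (nat_lit 41) = true := by decide +kernel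

theorem big_2083 : bigRange (nat_lit 2083) (nat_lit 31) = true := by decide +kernel

theorem big_2145 : bigRange (nat_lit 2145) (nat_lit 62) = true := by decide +kernel

theorem big_2269 : bigRange (nat_lit 2269) (nat_lit 42) = true := by decide +kernel

theorem big_2353 : bigRange (nat_lit 2353) (nat_lit 45) = true := by decide +kernel

theorem big_2443 : bigRange (nat_lit 2443) (nat_lit 75) = true := by decide +kernel

theorem big_2593 : bigRange (nat_lit 2593) (nat_lit 54) = true := by decide +kernel

theorem big_2701 : bigRange (nat_lit 2701) (nat_lit 67) = true := by decide +kernel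

theorem big_2835 : bigRange (nat_lit 2835) (nat_lit 84) = true := by decide +kernel

theorem big_3003 : bigRange (nat_lit 3003) (nat_lit 101) = true := by decide +kernel

theorem big_3205 : bigRange (nat_lit 3205) (nat_lit 94) = true := by decide +kernel

theorem big_3393 : bigRange (nat_lit 3393) (nat_lit 113) = true := by decide +kernel

theorem big_3619 : bigRange (nat_lit 3619) (nat_lit 132) = true := by decide +kernel

theorem big_3883 : bigRange (nat_lit 3883) (nat_lit 160) = true := by decide +kernel

theorem big_4203 : bigRange (nat_lit 4203) (nat_lit 183) = true := by decide +kernel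

theorem big_4569 : bigRange (nat_lit 4569) (nat_lit 221) = true := by decide +kernel

theorem big_5011 : bigRange (nat_lit 5011) (nat_lit 280) = true := by decide +kernel

theorem big_5571 : bigRange (nat_lit 5571) (nat_lit 347) = true := by decide +kernel

theorem big_6265 : bigRange (nat_lit 6265) (nat_lit 444) = true := by decide +kernel

theorem big_7153 : bigRange (nat_lit 7153) (nat_lit 619) = true := by decide +kernel

theorem big_8391 : bigRange (nat_lit 8391) (nat_lit 872) = true := by decide +kernel

theorem big_10135 : bigRange (nat_lit 10135) (nat_lit 1392) = true := by decide +kernel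

theorem big_12919 : bigRange (nat_lit 12919) (nat_lit 2503) = true := by decide +kernel

theorem big_17925 : bigRange (nat_lit 17925) (nat_lit 5940) = true := by decide +kernel

theorem big_29805 : bigRange (nat_lit 29805) (nat_lit 15000) = true := by decide +kernel

theorem big_59805 : bigRange (nat_lit 59805) (nat_lit 15000) = true := by decide +kernel

theorem big_89805 : bigRange (nat_lit 89805) (nat_lit 15000) = true := by decide +kernel

theorem big_119805 : bigRange (nat_lit 119805) (nat_lit 15000) = true := by decide +kernel

theorem big_149805 : bigRange (nat_lit 149805) (nat_lit 15000) = true := by decide +kernel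

theorem big_179805 : bigRange (nat_lit 179805) (nat_lit 15000) = true := by decide +kernel

theorem big_209805 : bigRange (nat_lit 209805) (nat_lit 3791) = true := by decide +kernel

/-- All large primes are covered. -/
theorem big_all {p : ℕ} (hodd : p % 2 = 1) (h1 : 2000 ≤ p) (h2 : p < 217387) :
    bigOne p = true := by
  by_cases h_2001 : p < 2083
  · exact bigRange_spec (p₀ := 2001) (D := 41) big_2001 p hodd (by norm_num) (by omega) (by omega)
  by_cases h_2083 : p < 2145
  · exact bigRange_spec (p₀ := 2083) (D := 31) big_2083 p hodd (by norm_num) (by omega) (by omega)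
  by_cases h_2145 : p < 2269
  · exact bigRange_spec (p₀ := 2145) (D := 62) big_2145 p hodd (by norm_num) (by omega) (by omega)
  by_cases h_2269 : p < 2353
  · exact bigRange_spec (p₀ := 2269) (D := 42) big_2269 p hodd (by norm_num) (by omega) (by omega)
  by_cases h_2353 : p < 2443
  · exact bigRange_spec (p₀ := 2353) (D := 45) big_2353 p hodd (by norm_num) (by omega) (by omega)
  by_cases h_2443 : p < 2593
  · exact bigRange_spec (p₀ := 2443) (D := 75) big_2443 p hodd (by norm_num) (by omega) (by omega)
  by_cases h_2593 : p < 2701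
  · exact bigRange_spec (p₀ := 2593) (D := 54) big_2593 p hodd (by norm_num) (by omega) (by omega)
  by_cases h_2701 : p < 2835
  · exact bigRange_spec (p₀ := 2701) (D := 67) big_2701 p hodd (by norm_num) (by omega) (by omega)
  by_cases h_2835 : p < 3003
  · exact bigRange_spec (p₀ := 2835) (D := 84) big_2835 p hodd (by norm_num) (by omega) (by omega)
  by_cases h_3003 : p < 3205
  · exact bigRange_spec (p₀ := 3003) (D := 101) big_3003 p hodd (by norm_num) (by omega) (by omega)
  by_cases h_3205 : p < 3393
  · exact bigRange_spec (p₀ := 3205) (D := 94) big_3205 p hodd (by norm_num) (by omega) (by omega)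
  by_cases h_3393 : p < 3619
  · exact bigRange_spec (p₀ := 3393) (D := 113) big_3393 p hodd (by norm_num) (by omega) (by omega)
  by_cases h_3619 : p < 3883
  · exact bigRange_spec (p₀ := 3619) (D := 132) big_3619 p hodd (by norm_num) (by omega) (by omega)
  by_cases h_3883 : p < 4203
  · exact bigRange_spec (p₀ := 3883) (D := 160) big_3883 p hodd (by norm_num) (by omega) (by omega)
  by_cases h_4203 : p < 4569
  · exact bigRange_spec (p₀ := 4203) (D := 183) big_4203 p hodd (by norm_num) (by omega) (by omega)
  by_cases h_4569 : p < 5011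
  · exact bigRange_spec (p₀ := 4569) (D := 221) big_4569 p hodd (by norm_num) (by omega) (by omega)
  by_cases h_5011 : p < 5571
  · exact bigRange_spec (p₀ := 5011) (D := 280) big_5011 p hodd (by norm_num) (by omega) (by omega)
  by_cases h_5571 : p < 6265
  · exact bigRange_spec (p₀ := 5571) (D := 347) big_5571 p hodd (by norm_num) (by omega) (by omega)
  by_cases h_6265 : p < 7153
  · exact bigRange_spec (p₀ := 6265) (D := 444) big_6265 p hodd (by norm_num) (by omega) (by omega)
  by_cases h_7153 : p < 8391
  · exact bigRange_spec (p₀ := 7153) (D := 619) big_7153 p hodd (by norm_num) (by omega) (by omega)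
  by_cases h_8391 : p < 10135
  · exact bigRange_spec (p₀ := 8391) (D := 872) big_8391 p hodd (by norm_num) (by omega) (by omega)
  by_cases h_10135 : p < 12919
  · exact bigRange_spec (p₀ := 10135) (D := 1392) big_10135 p hodd (by norm_num) (by omega) (by omega)
  by_cases h_12919 : p < 17925
  · exact bigRange_spec (p₀ := 12919) (D := 2503) big_12919 p hodd (by norm_num) (by omega) (by omega)
  by_cases h_17925 : p < 29805
  · exact bigRange_spec (p₀ := 17925) (D := 5940) big_17925 p hodd (by norm_num) (by omega) (by omega)
  by_cases h_29805 : p < 59805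
  · exact bigRange_spec (p₀ := 29805) (D := 15000) big_29805 p hodd (by norm_num) (by omega) (by omega)
  by_cases h_59805 : p < 89805
  · exact bigRange_spec (p₀ := 59805) (D := 15000) big_59805 p hodd (by norm_num) (by omega) (by omega)
  by_cases h_89805 : p < 119805
  · exact bigRange_spec (p₀ := 89805) (D := 15000) big_89805 p hodd (by norm_num) (by omega) (by omega)
  by_cases h_119805 : p < 149805
  · exact bigRange_spec (p₀ := 119805) (D := 15000) big_119805 p hodd (by norm_num) (by omega) (by omega)
  by_cases h_149805 : p < 179805
  · exact bigRange_spec (p₀ := 149805) (D := 15000) big_149805 p hodd (by norm_num) (by omega) (by omega)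
  by_cases h_179805 : p < 209805
  · exact bigRange_spec (p₀ := 179805) (D := 15000) big_179805 p hodd (by norm_num) (by omega) (by omega)
  exact bigRange_spec (p₀ := 209805) (D := 3791) big_209805 p hodd (by norm_num) (by omega) (by omega)

theorem rowSegment {P : ℕ → Prop} (i k : ℕ)
    (h1 : ∀ r ∈ ((oddRows.drop i).take k).flatten, P r)
    (h2 : ∀ r ∈ (oddRows.drop (i + k)).flatten, P r) : ∀ r ∈ (oddRows.drop i).flatten, P r := by
  intro r hr
  rw [← List.take_append_drop k (oddRows.drop i), List.flatten_append, List.mem_append,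
    List.drop_drop] at hr
  rcases hr with hr | hr
  · exact h1 r hr
  · exact h2 r hr

theorem mem_of_segment {i k r : ℕ} (h : r ∈ ((oddRows.drop i).take k).flatten) : r ∈ oddList := by
  rw [List.mem_flatten] at h
  obtain ⟨L, hL, hr⟩ := h
  exact List.mem_flatten.mpr ⟨L, List.mem_of_mem_drop (List.mem_of_mem_take hL), hr⟩

theorem segment_end {P : ℕ → Prop} : ∀ r ∈ (oddRows.drop 30).flatten, P r := by
  intro r hr
  have h : oddRows.drop 30 = [] := rfl
  rw [h] at hr
  simp at hr

theorem run_three_0 : branches (dfs [nat_lit 3, nat_lit 5, nat_lit 6, nat_lit 7])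
    (nat_lit 2) (nat_lit 36) (nat_lit 8) ((oddRows.drop 0).take 2) = true := by
  decide +kernel

theorem run_three_2 : branches (dfs [nat_lit 3, nat_lit 5, nat_lit 6, nat_lit 7])
    (nat_lit 2) (nat_lit 36) (nat_lit 8) ((oddRows.drop 2).take 2) = true := by
  decide +kernel

theorem run_three_4 : branches (dfs [nat_lit 3, nat_lit 5, nat_lit 6, nat_lit 7])
    (nat_lit 2) (nat_lit 36) (nat_lit 8) ((oddRows.drop 4).take 3) = true := by
  decide +kernel

theorem run_three_7 : branches (dfs [nat_lit 3, nat_lit 5, nat_lit 6, nat_lit 7])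
    (nat_lit 2) (nat_lit 36) (nat_lit 8) ((oddRows.drop 7).take 4) = true := by
  decide +kernel

theorem run_three_11 : branches (dfs [nat_lit 3, nat_lit 5, nat_lit 6, nat_lit 7])
    (nat_lit 2) (nat_lit 36) (nat_lit 8) ((oddRows.drop 11).take 4) = true := by
  decide +kernel

theorem run_three_15 : branches (dfs [nat_lit 3, nat_lit 5, nat_lit 6, nat_lit 7])
    (nat_lit 2) (nat_lit 36) (nat_lit 8) ((oddRows.drop 15).take 4) = true := by
  decide +kernel

theorem run_three_19 : branches (dfs [nat_lit 3, nat_lit 5, nat_lit 6, nat_lit 7])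
    (nat_lit 2) (nat_lit 36) (nat_lit 8) ((oddRows.drop 19).take 11) = true := by
  decide +kernel

theorem good_3 : Good [2, 3, 5, 6, 7] 36 8 := by
  apply good_of_steps
  show ∀ r ∈ (oddRows.drop 0).flatten, _
  refine rowSegment 0 2
    (fun r hr => part_spec (by decide) run_three_0 r hr (mem_of_segment hr)) ?_
  refine rowSegment 2 2
    (fun r hr => part_spec (by decide) run_three_2 r hr (mem_of_segment hr)) ?_
  refine rowSegment 4 3
    (fun r hr => part_spec (by decide) run_three_4 r hr (mem_of_segment hr)) ?_
  refine rowSegment 7 4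
    (fun r hr => part_spec (by decide) run_three_7 r hr (mem_of_segment hr)) ?_
  refine rowSegment 11 4
    (fun r hr => part_spec (by decide) run_three_11 r hr (mem_of_segment hr)) ?_
  refine rowSegment 15 4
    (fun r hr => part_spec (by decide) run_three_15 r hr (mem_of_segment hr)) ?_
  refine rowSegment 19 11
    (fun r hr => part_spec (by decide) run_three_19 r hr (mem_of_segment hr)) ?_
  exact segment_end

theorem run_five_0 : branches (dfs [nat_lit 3, nat_lit 5, nat_lit 6, nat_lit 7])
    (nat_lit 2) (nat_lit 100) (nat_lit 24) ((oddRows.drop 0).take 2) = true := by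
  decide +kernel

theorem run_five_2 : branches (dfs [nat_lit 3, nat_lit 5, nat_lit 6, nat_lit 7])
    (nat_lit 2) (nat_lit 100) (nat_lit 24) ((oddRows.drop 2).take 3) = true := by
  decide +kernel

theorem run_five_5 : branches (dfs [nat_lit 3, nat_lit 5, nat_lit 6, nat_lit 7])
    (nat_lit 2) (nat_lit 100) (nat_lit 24) ((oddRows.drop 5).take 6) = true := by
  decide +kernel

theorem run_five_11 : branches (dfs [nat_lit 3, nat_lit 5, nat_lit 6, nat_lit 7])
    (nat_lit 2) (nat_lit 100) (nat_lit 24) ((oddRows.drop 11).take 5) = true := by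
  decide +kernel

theorem run_five_16 : branches (dfs [nat_lit 3, nat_lit 5, nat_lit 6, nat_lit 7])
    (nat_lit 2) (nat_lit 100) (nat_lit 24) ((oddRows.drop 16).take 14) = true := by
  decide +kernel

theorem good_5 : Good [2, 3, 5, 6, 7] 100 24 := by
  apply good_of_steps
  show ∀ r ∈ (oddRows.drop 0).flatten, _
  refine rowSegment 0 2
    (fun r hr => part_spec (by decide) run_five_0 r hr (mem_of_segment hr)) ?_
  refine rowSegment 2 3
    (fun r hr => part_spec (by decide) run_five_2 r hr (mem_of_segment hr)) ?_
  refine rowSegment 5 6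
    (fun r hr => part_spec (by decide) run_five_5 r hr (mem_of_segment hr)) ?_
  refine rowSegment 11 5
    (fun r hr => part_spec (by decide) run_five_11 r hr (mem_of_segment hr)) ?_
  refine rowSegment 16 14
    (fun r hr => part_spec (by decide) run_five_16 r hr (mem_of_segment hr)) ?_
  exact segment_end

theorem run_seven_0 : branches (dfs [nat_lit 3, nat_lit 5, nat_lit 6, nat_lit 7])
    (nat_lit 2) (nat_lit 196) (nat_lit 48) ((oddRows.drop 0).take 1) = true := by
  decide +kernel

theorem run_seven_1 : branches (dfs [nat_lit 3, nat_lit 5, nat_lit 6, nat_lit 7])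
    (nat_lit 2) (nat_lit 196) (nat_lit 48) ((oddRows.drop 1).take 6) = true := by
  decide +kernel

theorem run_seven_7 : branches (dfs [nat_lit 3, nat_lit 5, nat_lit 6, nat_lit 7])
    (nat_lit 2) (nat_lit 196) (nat_lit 48) ((oddRows.drop 7).take 8) = true := by
  decide +kernel

theorem run_seven_15 : branches (dfs [nat_lit 3, nat_lit 5, nat_lit 6, nat_lit 7])
    (nat_lit 2) (nat_lit 196) (nat_lit 48) ((oddRows.drop 15).take 15) = true := by
  decide +kernel

theorem good_7 : Good [2, 3, 5, 6, 7] 196 48 := by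
  apply good_of_steps
  show ∀ r ∈ (oddRows.drop 0).flatten, _
  refine rowSegment 0 1
    (fun r hr => part_spec (by decide) run_seven_0 r hr (mem_of_segment hr)) ?_
  refine rowSegment 1 6
    (fun r hr => part_spec (by decide) run_seven_1 r hr (mem_of_segment hr)) ?_
  refine rowSegment 7 8
    (fun r hr => part_spec (by decide) run_seven_7 r hr (mem_of_segment hr)) ?_
  refine rowSegment 15 15
    (fun r hr => part_spec (by decide) run_seven_15 r hr (mem_of_segment hr)) ?_
  exact segment_end

theorem run_eleven_0 : branches (dfs [nat_lit 3, nat_lit 5, nat_lit 6, nat_lit 7])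
    (nat_lit 2) (nat_lit 484) (nat_lit 120) ((oddRows.drop 0).take 5) = true := by
  decide +kernel

theorem run_eleven_5 : branches (dfs [nat_lit 3, nat_lit 5, nat_lit 6, nat_lit 7])
    (nat_lit 2) (nat_lit 484) (nat_lit 120) ((oddRows.drop 5).take 11) = true := by
  decide +kernel

theorem run_eleven_16 : branches (dfs [nat_lit 3, nat_lit 5, nat_lit 6, nat_lit 7])
    (nat_lit 2) (nat_lit 484) (nat_lit 120) ((oddRows.drop 16).take 14) = true := by
  decide +kernel

theorem good_11 : Good [2, 3, 5, 6, 7] 484 120 := by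
  apply good_of_steps
  show ∀ r ∈ (oddRows.drop 0).flatten, _
  refine rowSegment 0 5
    (fun r hr => part_spec (by decide) run_eleven_0 r hr (mem_of_segment hr)) ?_
  refine rowSegment 5 11
    (fun r hr => part_spec (by decide) run_eleven_5 r hr (mem_of_segment hr)) ?_
  refine rowSegment 16 14
    (fun r hr => part_spec (by decide) run_eleven_16 r hr (mem_of_segment hr)) ?_
  exact segment_end

theorem run_thirteen_0 : branches (dfs [nat_lit 3, nat_lit 5, nat_lit 6, nat_lit 7])
    (nat_lit 2) (nat_lit 676) (nat_lit 168) ((oddRows.drop 0).take 7) = true := by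
  decide +kernel

theorem run_thirteen_7 : branches (dfs [nat_lit 3, nat_lit 5, nat_lit 6, nat_lit 7])
    (nat_lit 2) (nat_lit 676) (nat_lit 168) ((oddRows.drop 7).take 23) = true := by
  decide +kernel

theorem good_13 : Good [2, 3, 5, 6, 7] 676 168 := by
  apply good_of_steps
  show ∀ r ∈ (oddRows.drop 0).flatten, _
  refine rowSegment 0 7
    (fun r hr => part_spec (by decide) run_thirteen_0 r hr (mem_of_segment hr)) ?_
  refine rowSegment 7 23
    (fun r hr => part_spec (by decide) run_thirteen_7 r hr (mem_of_segment hr)) ?_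
  exact segment_end

theorem run_seventeen_0 : branches (dfs [nat_lit 3, nat_lit 5, nat_lit 6, nat_lit 7])
    (nat_lit 2) (nat_lit 1156) (nat_lit 288) ((oddRows.drop 0).take 11) = true := by
  decide +kernel

theorem run_seventeen_11 : branches (dfs [nat_lit 3, nat_lit 5, nat_lit 6, nat_lit 7])
    (nat_lit 2) (nat_lit 1156) (nat_lit 288) ((oddRows.drop 11).take 19) = true := by
  decide +kernel

theorem good_17 : Good [2, 3, 5, 6, 7] 1156 288 := by
  apply good_of_steps
  show ∀ r ∈ (oddRows.drop 0).flatten, _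
  refine rowSegment 0 11
    (fun r hr => part_spec (by decide) run_seventeen_0 r hr (mem_of_segment hr)) ?_
  refine rowSegment 11 19
    (fun r hr => part_spec (by decide) run_seventeen_11 r hr (mem_of_segment hr)) ?_
  exact segment_end

theorem run_root_6 : branches (dfs [nat_lit 2, nat_lit 3, nat_lit 5, nat_lit 6, nat_lit 7])
    (nat_lit 1) (nat_lit 4) (nat_lit 0) ((oddRows.drop 6).take 1) = true := by
  decide +kernel

theorem run_root_7 : branches (dfs [nat_lit 2, nat_lit 3, nat_lit 5, nat_lit 6, nat_lit 7])
    (nat_lit 1) (nat_lit 4) (nat_lit 0) ((oddRows.drop 7).take 1) = true := by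
  decide +kernel

theorem run_root_8 : branches (dfs [nat_lit 2, nat_lit 3, nat_lit 5, nat_lit 6, nat_lit 7])
    (nat_lit 1) (nat_lit 4) (nat_lit 0) ((oddRows.drop 8).take 1) = true := by
  decide +kernel

theorem run_root_9 : branches (dfs [nat_lit 2, nat_lit 3, nat_lit 5, nat_lit 6, nat_lit 7])
    (nat_lit 1) (nat_lit 4) (nat_lit 0) ((oddRows.drop 9).take 1) = true := by
  decide +kernel

theorem run_root_10 : branches (dfs [nat_lit 2, nat_lit 3, nat_lit 5, nat_lit 6, nat_lit 7])
    (nat_lit 1) (nat_lit 4) (nat_lit 0) ((oddRows.drop 10).take 1) = true := by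
  decide +kernel

theorem run_root_11 : branches (dfs [nat_lit 2, nat_lit 3, nat_lit 5, nat_lit 6, nat_lit 7])
    (nat_lit 1) (nat_lit 4) (nat_lit 0) ((oddRows.drop 11).take 1) = true := by
  decide +kernel

theorem run_root_12 : branches (dfs [nat_lit 2, nat_lit 3, nat_lit 5, nat_lit 6, nat_lit 7])
    (nat_lit 1) (nat_lit 4) (nat_lit 0) ((oddRows.drop 12).take 1) = true := by
  decide +kernel

theorem run_root_13 : branches (dfs [nat_lit 2, nat_lit 3, nat_lit 5, nat_lit 6, nat_lit 7])
    (nat_lit 1) (nat_lit 4) (nat_lit 0) ((oddRows.drop 13).take 1) = true := by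
  decide +kernel

theorem run_root_14 : branches (dfs [nat_lit 2, nat_lit 3, nat_lit 5, nat_lit 6, nat_lit 7])
    (nat_lit 1) (nat_lit 4) (nat_lit 0) ((oddRows.drop 14).take 1) = true := by
  decide +kernel

theorem run_root_15 : branches (dfs [nat_lit 2, nat_lit 3, nat_lit 5, nat_lit 6, nat_lit 7])
    (nat_lit 1) (nat_lit 4) (nat_lit 0) ((oddRows.drop 15).take 1) = true := by
  decide +kernel

theorem run_root_16 : branches (dfs [nat_lit 2, nat_lit 3, nat_lit 5, nat_lit 6, nat_lit 7])
    (nat_lit 1) (nat_lit 4) (nat_lit 0) ((oddRows.drop 16).take 1) = true := by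
  decide +kernel

theorem run_root_17 : branches (dfs [nat_lit 2, nat_lit 3, nat_lit 5, nat_lit 6, nat_lit 7])
    (nat_lit 1) (nat_lit 4) (nat_lit 0) ((oddRows.drop 17).take 1) = true := by
  decide +kernel

theorem run_root_18 : branches (dfs [nat_lit 2, nat_lit 3, nat_lit 5, nat_lit 6, nat_lit 7])
    (nat_lit 1) (nat_lit 4) (nat_lit 0) ((oddRows.drop 18).take 1) = true := by
  decide +kernel

theorem run_root_19 : branches (dfs [nat_lit 2, nat_lit 3, nat_lit 5, nat_lit 6, nat_lit 7])
    (nat_lit 1) (nat_lit 4) (nat_lit 0) ((oddRows.drop 19).take 2) = true := by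
  decide +kernel

theorem run_root_21 : branches (dfs [nat_lit 2, nat_lit 3, nat_lit 5, nat_lit 6, nat_lit 7])
    (nat_lit 1) (nat_lit 4) (nat_lit 0) ((oddRows.drop 21).take 3) = true := by
  decide +kernel

theorem run_root_24 : branches (dfs [nat_lit 2, nat_lit 3, nat_lit 5, nat_lit 6, nat_lit 7])
    (nat_lit 1) (nat_lit 4) (nat_lit 0) ((oddRows.drop 24).take 4) = true := by
  decide +kernel

theorem run_root_28 : branches (dfs [nat_lit 2, nat_lit 3, nat_lit 5, nat_lit 6, nat_lit 7])
    (nat_lit 1) (nat_lit 4) (nat_lit 0) ((oddRows.drop 28).take 2) = true := by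
  decide +kernel

theorem good_root : Good [1, 2, 3, 5, 6, 7] 4 0 := by
  apply good_of_steps
  show ∀ r ∈ (oddRows.drop 0).flatten, _
  refine rowSegment 0 6 ?_ ?_
  · intro r hr
    have h : r ∈ [3, 5, 7, 11, 13, 17] := hr
    simp only [List.mem_cons, List.not_mem_nil, or_false] at h
    rcases h with rfl | rfl | rfl | rfl | rfl | rfl
    · exact stepGood_of_good (k := 2) (by decide) (by decide) (by norm_num) (by norm_num)
        (by norm_num) (Or.inr good_3)
    · exact stepGood_of_good (k := 6) (by decide) (by decide) (by norm_num) (by norm_num)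
        (by norm_num) (Or.inr good_5)
    · exact stepGood_of_good (k := 12) (by decide) (by decide) (by norm_num) (by norm_num)
        (by norm_num) (Or.inr good_7)
    · exact stepGood_of_good (k := 30) (by decide) (by decide) (by norm_num) (by norm_num)
        (by norm_num) (Or.inr good_11)
    · exact stepGood_of_good (k := 42) (by decide) (by decide) (by norm_num) (by norm_num)
        (by norm_num) (Or.inr good_13)
    · exact stepGood_of_good (k := 72) (by decide) (by decide) (by norm_num) (by norm_num)
        (by norm_num) (Or.inr good_17)
  refine rowSegment 6 1
    (fun r hr => part_spec (by decide) run_root_6 r hr (mem_of_segment hr)) ?_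
  refine rowSegment 7 1
    (fun r hr => part_spec (by decide) run_root_7 r hr (mem_of_segment hr)) ?_
  refine rowSegment 8 1
    (fun r hr => part_spec (by decide) run_root_8 r hr (mem_of_segment hr)) ?_
  refine rowSegment 9 1
    (fun r hr => part_spec (by decide) run_root_9 r hr (mem_of_segment hr)) ?_
  refine rowSegment 10 1
    (fun r hr => part_spec (by decide) run_root_10 r hr (mem_of_segment hr)) ?_
  refine rowSegment 11 1
    (fun r hr => part_spec (by decide) run_root_11 r hr (mem_of_segment hr)) ?_
  refine rowSegment 12 1
    (fun r hr => part_spec (by decide) run_root_12 r hr (mem_of_segment hr)) ?_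
  refine rowSegment 13 1
    (fun r hr => part_spec (by decide) run_root_13 r hr (mem_of_segment hr)) ?_
  refine rowSegment 14 1
    (fun r hr => part_spec (by decide) run_root_14 r hr (mem_of_segment hr)) ?_
  refine rowSegment 15 1
    (fun r hr => part_spec (by decide) run_root_15 r hr (mem_of_segment hr)) ?_
  refine rowSegment 16 1
    (fun r hr => part_spec (by decide) run_root_16 r hr (mem_of_segment hr)) ?_
  refine rowSegment 17 1
    (fun r hr => part_spec (by decide) run_root_17 r hr (mem_of_segment hr)) ?_
  refine rowSegment 18 1
    (fun r hr => part_spec (by decide) run_root_18 r hr (mem_of_segment hr)) ?_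
  refine rowSegment 19 2
    (fun r hr => part_spec (by decide) run_root_19 r hr (mem_of_segment hr)) ?_
  refine rowSegment 21 3
    (fun r hr => part_spec (by decide) run_root_21 r hr (mem_of_segment hr)) ?_
  refine rowSegment 24 4
    (fun r hr => part_spec (by decide) run_root_24 r hr (mem_of_segment hr)) ?_
  refine rowSegment 28 2
    (fun r hr => part_spec (by decide) run_root_28 r hr (mem_of_segment hr)) ?_
  exact segment_end

/-! ### The main theorem -/

theorem exists_odd_sq {n : ℕ} (h : ¬ Squarefree n) (h4 : n % 4 ≠ 0) :
    ∃ p, p.Prime ∧ p ≠ 2 ∧ p * p ∣ n := by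
  rw [Nat.squarefree_iff_prime_squarefree] at h
  push Not at h
  obtain ⟨p, hp, hd⟩ := h
  refine ⟨p, hp, ?_, hd⟩
  rintro rfl
  omega

theorem small_or_large {n : ℕ} (h : ¬ Squarefree n) (h4 : n % 4 ≠ 0) :
    SmallSq n ∨ ∃ p, p.Prime ∧ 2000 ≤ p ∧ p * p ∣ n := by
  obtain ⟨p, hp, h2, hd⟩ := exists_odd_sq h h4
  rcases lt_or_ge p 2000 with hlt | hge
  · exact Or.inl ⟨p, hp, mem_oddList hp h2 hlt, hd⟩
  · exact Or.inr ⟨p, hp, hge, hd⟩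

theorem large_case {p t w : ℕ} (hp : p.Prime) (h2 : 2000 ≤ p)
    (ht : t ≤ topZ) (ht4 : t % 4 = 0) (hw : w = 1 ∨ w = 2 ∨ w = 3) (hd : p * p ∣ t + w)
    (hs : ¬ Squarefree (t + 1) ∧ ¬ Squarefree (t + 2) ∧ ¬ Squarefree (t + 3)) :
    ¬ Bad t ∧ ∀ b, b + 4 = t → ¬ Bad b := by
  refine bigOne_spec hp h2 (big_all ?_ h2 ?_) ht ht4 hw hd hs
  · exact hp.eq_two_or_odd.resolve_left (by omega)
  · have h3 := Nat.le_of_dvd (by omega) hd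
    rw [topZ_eq] at ht
    by_contra hc
    have : 217387 * 217387 ≤ p * p := Nat.mul_le_mul (by omega) (by omega)
    omega

theorem not_bad {b : ℕ} (h4 : b % 4 = 0) (hb : b + 4 ≤ topZ) : ¬ Bad b := by
  intro h
  obtain ⟨⟨h1, h2, h3⟩, ⟨h5, h6, h7⟩, he⟩ := id h
  have lowCase : ∀ w, (w = 1 ∨ w = 2 ∨ w = 3) → ¬ Squarefree (b + w) → SmallSq (b + w) := by
    intro w hw hs
    rcases small_or_large hs (by omega) with h | ⟨p, hp, hp2, hd⟩
    · exact h
    · exact absurd h (large_case hp hp2 (by omega) h4 hw hd ⟨h1, h2, h3⟩).1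
  have highCase : ∀ w, (w = 1 ∨ w = 2 ∨ w = 3) → ¬ Squarefree (b + 4 + w) →
      SmallSq (b + 4 + w) := by
    intro w hw hs
    rcases small_or_large hs (by omega) with h | ⟨p, hp, hp2, hd⟩
    · exact h
    · exact absurd h ((large_case hp hp2 hb (by omega) hw hd ⟨h5, h6, h7⟩).2 b rfl)
  refine good_root b ⟨by norm_num, by omega, h4, ?_, ?_, he⟩
  · intro r hr hr' hrd
    have h8 : r ∣ 2 * 2 := hrd
    have h9 := (oddList_lt r hr').2
    have h10 : r ≤ 2 := Nat.le_of_dvd (by norm_num) (by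
      rcases hr.dvd_mul.mp h8 with h | h <;> exact h)
    omega
  · intro u hu
    simp only [List.mem_cons, List.not_mem_nil, or_false] at hu
    rcases hu with rfl | rfl | rfl | rfl | rfl | rfl
    · exact lowCase 1 (by norm_num) h1
    · exact lowCase 2 (by norm_num) h2
    · exact lowCase 3 (by norm_num) h3
    · exact highCase 1 (by norm_num) h5
    · exact highCase 2 (by norm_num) h6
    · exact highCase 3 (by norm_num) h7

theorem not_squarefree_of {n p : ℕ} (hp : 1 < p) (h : n % (p * p) = 0) : ¬ Squarefree n := by
  intro hs
  have := Nat.isUnit_iff.mp (hs p (Nat.dvd_of_mod_eq_zero h))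
  omega

theorem squarefree_left : Squarefree 47255689914 :=
  sfx_spec (by norm_num) (by decide +kernel)

theorem squarefree_right : Squarefree 47255689927 :=
  sfx_spec (by norm_num) (by decide +kernel)

/-- Qgap(12) = 47255689915. -/
theorem qgap_12 : IsLeast {N : ℕ | StartsSquarefreeGap N 12} 47255689915 := by
  constructor
  · refine ⟨by norm_num, by norm_num, ?_, squarefree_left, squarefree_right⟩
    intro i hi
    interval_cases i
    · exact not_squarefree_of (p := 7) (by norm_num) (by norm_num)
    · exact not_squarefree_of (p := 2) (by norm_num) (by norm_num)
    · exact not_squarefree_of (p := 3) (by norm_num) (by norm_num)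
    · exact not_squarefree_of (p := 103) (by norm_num) (by norm_num)
    · exact not_squarefree_of (p := 43) (by norm_num) (by norm_num)
    · exact not_squarefree_of (p := 2) (by norm_num) (by norm_num)
    · exact not_squarefree_of (p := 29) (by norm_num) (by norm_num)
    · exact not_squarefree_of (p := 17) (by norm_num) (by norm_num)
    · exact not_squarefree_of (p := 13) (by norm_num) (by norm_num)
    · exact not_squarefree_of (p := 2) (by norm_num) (by norm_num)
    · exact not_squarefree_of (p := 5) (by norm_num) (by norm_num)
    · exact not_squarefree_of (p := 3) (by norm_num) (by norm_num)
  · rintro N ⟨hN, -, hwin, -, -⟩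
    by_contra hlt
    have hw : ∀ n, N ≤ n → n < N + 12 → ¬ Squarefree n := by
      intro n h1 h2
      have h3 := hwin (n - N) (by omega)
      rwa [Nat.add_sub_cancel' h1] at h3
    obtain ⟨m, hm⟩ : ∃ m, m = (N + 2) / 4 := ⟨_, rfl⟩
    rcases lt_or_ge (4 * m) 47255689912 with hb | hb
    · refine not_bad (b := 4 * m) (by omega) (by rw [topZ_eq]; omega)
        ⟨⟨?_, ?_, ?_⟩, ⟨?_, ?_, ?_⟩, ?_, ?_⟩
      · exact hw _ (by omega) (by omega)
      · exact hw _ (by omega) (by omega)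
      · exact hw _ (by omega) (by omega)
      · exact hw _ (by omega) (by omega)
      · exact hw _ (by omega) (by omega)
      · exact hw _ (by omega) (by omega)
      · exact hw _ (by omega) (by omega)
      · have hr : N + 2 = 4 * m ∨ N + 1 = 4 * m ∨ N = 4 * m ∨ N = 4 * m + 1 := by omega
        rcases hr with hr | hr | hr
        · exact Or.inl ⟨hw _ (by omega) (by omega), hw _ (by omega) (by omega)⟩
        · exact Or.inr (Or.inl ⟨hw _ (by omega) (by omega), hw _ (by omega) (by omega)⟩)
        · exact Or.inr (Or.inr ⟨hw _ (by omega) (by omega), hw _ (by omega) (by omega)⟩)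
    · exact hw 47255689914 (by omega) (by omega) squarefree_left
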